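/- arXiv:2106.09688 — 2 statements merged into one kernel-verified Lean document; each statement's English description precedes it below -/
import Mathlib

section
/- For every integer k ≥ 4 and every constant 1/k < η ≤ 1 there exists α > 0 such that the following holds for all sufficiently large n ∈ ℕ divisible by k: every n-vertex graph G with minimum degree δ(G) ≥ ηn and α*(G) ≤ αn contains a perfect C_k-tiling (a C_k-factor covering every vertex of G), where C_k denotes the cycle on k vertices. -/
open Finset

namespace RTT

variable {k n : ℕ}

/-- `S` spans a copy of the `k`-vertex graph `F` in `G`:
there is an injective graph homomorphism from `F` to `G` with image exactly `S`. -/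
def SpansCopy (F : SimpleGraph (Fin k)) (G : SimpleGraph (Fin n))
    (S : Finset (Fin n)) : Prop :=
  ∃ f : Fin k → Fin n, Function.Injective f ∧
    (∀ a b, F.Adj a b → G.Adj (f a) (f b)) ∧ Finset.image f Finset.univ = S

/-- `T` is an `F`-tiling in `G`: a collection of pairwise vertex-disjoint vertex sets,
each spanning a copy of `F`. -/
def IsTiling (F : SimpleGraph (Fin k)) (G : SimpleGraph (Fin n))
    (T : Finset (Finset (Fin n))) : Prop :=
  (∀ S ∈ T, SpansCopy F G S) ∧ ∀ S ∈ T, ∀ S' ∈ T, S ≠ S' → Disjoint S S'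

/-- The induced subgraph of `G` on the vertex set `A` has a perfect `F`-tiling. -/
def PerfTilingOn (F : SimpleGraph (Fin k)) (G : SimpleGraph (Fin n))
    (A : Finset (Fin n)) : Prop :=
  ∃ T : Finset (Finset (Fin n)), IsTiling F G T ∧ T.biUnion id = A

/-- The minimum degree of `G` is at least `x`. -/
def MinDegGE (G : SimpleGraph (Fin n)) (x : ℝ) : Prop :=
  ∀ v : Fin n, x ≤ ((G.neighborSet v).ncard : ℝ)

/-- The `r`-independence number of `G` is at most `x`: every vertex set whose induced
subgraph contains no copy of `K_r` has size at most `x`. -/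
def IndepBound (G : SimpleGraph (Fin n)) (r : ℕ) (x : ℝ) : Prop :=
  ∀ S : Finset (Fin n), (∀ T ⊆ S, ¬ G.IsNClique r T) → (S.card : ℝ) ≤ x

/-- `α*(G) ≤ x`: every bipartite hole of `G` has size at most `x`. -/
def HoleBound (G : SimpleGraph (Fin n)) (x : ℝ) : Prop :=
  ∀ (s : ℕ) (U₁ U₂ : Finset (Fin n)), Disjoint U₁ U₂ → U₁.card = s → U₂.card = s →
    (∀ u ∈ U₁, ∀ v ∈ U₂, ¬ G.Adj u v) → (s : ℝ) ≤ x

/-- `A` is a `ξ`-absorbing set with respect to `V'` (for the `k`-vertex graph `F`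
in the `n`-vertex graph `G`). -/
def IsAbsorbingSet (F : SimpleGraph (Fin k)) (G : SimpleGraph (Fin n)) (ξ : ℝ)
    (V' A : Finset (Fin n)) : Prop :=
  ∀ U : Finset (Fin n), U ⊆ V' \ A → (U.card : ℝ) ≤ ξ * n →
    k ∣ (A ∪ U).card → PerfTilingOn F G (A ∪ U)

/-- `A` is an `(F,t)`-absorber for the `k`-set `S`. -/
def IsAbsorber (F : SimpleGraph (Fin k)) (G : SimpleGraph (Fin n)) (t : ℕ)
    (S A : Finset (Fin n)) : Prop :=
  Disjoint A S ∧ A.card ≤ k ^ 2 * t ∧ PerfTilingOn F G A ∧ PerfTilingOn F G (A ∪ S)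

/-- `S` has a family of at least `x` pairwise vertex-disjoint `(F,t)`-absorbers in `G`. -/
def HasManyAbsorbers (F : SimpleGraph (Fin k)) (G : SimpleGraph (Fin n)) (t : ℕ)
    (S : Finset (Fin n)) (x : ℝ) : Prop :=
  ∃ 𝒜 : Finset (Finset (Fin n)), x ≤ (𝒜.card : ℝ) ∧
    (∀ A ∈ 𝒜, IsAbsorber F G t S A) ∧
    ∀ A ∈ 𝒜, ∀ A' ∈ 𝒜, A ≠ A' → Disjoint A A'

/-- `𝒮` is an `F`-fan at `v` in `U`: a collection of pairwise disjoint `(k-1)`-sets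
`S ⊆ U \ {v}` such that `{v} ∪ S` spans a copy of `F`; its size is `𝒮.card`. -/
def IsFan (F : SimpleGraph (Fin k)) (G : SimpleGraph (Fin n)) (v : Fin n)
    (U : Finset (Fin n)) (𝒮 : Finset (Finset (Fin n))) : Prop :=
  (∀ S ∈ 𝒮, S ⊆ U.erase v ∧ S.card = k - 1 ∧ SpansCopy F G (insert v S)) ∧
    ∀ S ∈ 𝒮, ∀ S' ∈ 𝒮, S ≠ S' → Disjoint S S'

/-- `u` and `v` are `(F, m, t)`-reachable in `G`. -/
def FReachable (F : SimpleGraph (Fin k)) (G : SimpleGraph (Fin n)) (m : ℝ) (t : ℕ)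
    (u v : Fin n) : Prop :=
  ∀ W : Finset (Fin n), (W.card : ℝ) ≤ m →
    ∃ S : Finset (Fin n), Disjoint S W ∧ u ∉ S ∧ v ∉ S ∧ S.card ≤ k * t - 1 ∧
      PerfTilingOn F G (insert u S) ∧ PerfTilingOn F G (insert v S)

/-- `U` is `(F, m, t)`-closed in `G`. -/
def FClosed (F : SimpleGraph (Fin k)) (G : SimpleGraph (Fin n)) (m : ℝ) (t : ℕ)
    (U : Finset (Fin n)) : Prop :=
  ∀ u ∈ U, ∀ v ∈ U, u ≠ v → FReachable F G m t u v

/-- `P` is a partition of the vertex set of an `n`-vertex graph into `C` parts. -/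
def IsPartition {C : ℕ} (P : Fin C → Finset (Fin n)) : Prop :=
  (∀ i j, i ≠ j → Disjoint (P i) (P j)) ∧ Finset.univ.biUnion P = Finset.univ

/-- The `k`-vector `v` is `(F, β)`-robust with respect to the partition `P`:
it has coordinate sum `k`, and avoiding any set `W` of at most `βn` vertices there is
a copy of `F` whose vertex set has index vector `v`. -/
def RobustVec (F : SimpleGraph (Fin k)) (G : SimpleGraph (Fin n)) {C : ℕ}
    (P : Fin C → Finset (Fin n)) (β : ℝ) (v : Fin C → ℕ) : Prop :=
  (∑ i, v i) = k ∧
    ∀ W : Finset (Fin n), (W.card : ℝ) ≤ β * n →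
      ∃ S : Finset (Fin n), Disjoint S W ∧ SpansCopy F G S ∧ ∀ i, (S ∩ P i).card = v i

end RTT

namespace RTT

def Til (k : ℕ) {n : ℕ} (G : SimpleGraph (Fin n)) (A : Finset (Fin n)) : Prop :=
  PerfTilingOn (SimpleGraph.cycleGraph k) G A

lemma til_empty (k : ℕ) {n : ℕ} (G : SimpleGraph (Fin n)) : Til k G ∅ :=
  ⟨∅, ⟨by simp, by simp⟩, by simp⟩

lemma til_union {k n : ℕ} {G : SimpleGraph (Fin n)} {A B : Finset (Fin n)}
    (hA : Til k G A) (hB : Til k G B) (h : Disjoint A B) : Til k G (A ∪ B) := by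
  obtain ⟨T, ⟨hT1, hT2⟩, rfl⟩ := hA
  obtain ⟨T', ⟨hT1', hT2'⟩, rfl⟩ := hB
  refine ⟨T ∪ T', ⟨?_, ?_⟩, ?_⟩
  · intro S hS
    rcases Finset.mem_union.1 hS with h | h
    · exact hT1 S h
    · exact hT1' S h
  · have key : ∀ S ∈ T, ∀ S' ∈ T', Disjoint S S' := fun S hS S' hS' =>
      Disjoint.mono (Finset.subset_biUnion_of_mem id hS) (Finset.subset_biUnion_of_mem id hS') h
    intro S hS S' hS' hne
    rcases Finset.mem_union.1 hS with h | h <;> rcases Finset.mem_union.1 hS' with h' | h'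
    · exact hT2 S h S' h' hne
    · exact key _ h _ h'
    · exact (key _ h' _ h).symm
    · exact hT2' S h S' h' hne
  · exact Finset.union_biUnion

lemma spans_list {k n : ℕ} (hk : 2 ≤ k) {G : SimpleGraph (Fin n)} (L : List (Fin n))
    (hL : L.length = k) (hn : L.Nodup) (hc : L.IsChain G.Adj)
    (hl : ∀ x ∈ L.head?, ∀ y ∈ L.getLast?, G.Adj y x) :
    SpansCopy (SimpleGraph.cycleGraph k) G L.toFinset := by
  subst hL
  have hstep : ∀ a b : Fin L.length, (b - a).val = 1 → G.Adj L[a] L[b] := by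
    intro a b hab
    have ha := a.2
    have hb := b.2
    rw [Fin.val_sub] at hab
    by_cases h : a.val + 1 < L.length
    · have hb' : b.val = a.val + 1 := by
        by_cases h2 : a.val ≤ b.val
        · rw [show L.length - a.val + b.val = (b.val - a.val) + L.length by omega,
            Nat.add_mod_right, Nat.mod_eq_of_lt (by omega)] at hab
          omega
        · rw [Nat.mod_eq_of_lt (by omega)] at hab
          omega
      have := List.isChain_iff_getElem.1 hc a.val h
      simp only [Fin.getElem_fin, hb']
      exact this
    · have ha' : a.val = L.length - 1 := by omega
      have hb' : b.val = 0 := by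
        by_cases h2 : a.val ≤ b.val
        · rw [show L.length - a.val + b.val = (b.val - a.val) + L.length by omega,
            Nat.add_mod_right, Nat.mod_eq_of_lt (by omega)] at hab
          omega
        · rw [Nat.mod_eq_of_lt (by omega)] at hab
          omega
      simp only [Fin.getElem_fin, hb', ha']
      apply hl
      · rw [List.head?_eq_getElem?]; simp
      · rw [List.getLast?_eq_getElem?]; simp
  refine ⟨fun i => L[i], ?_, ?_, ?_⟩
  · intro i j hij
    exact Fin.ext ((List.Nodup.getElem_inj_iff hn).1 hij)
  · intro a b hab
    rw [SimpleGraph.cycleGraph_adj'] at hab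
    rcases hab with h | h
    · exact (hstep b a h).symm
    · exact hstep a b h
  · ext x
    simp only [Finset.mem_image, Finset.mem_univ, true_and, List.mem_toFinset,
      Fin.getElem_fin]
    rw [List.mem_iff_getElem]
    constructor
    · rintro ⟨i, rfl⟩; exact ⟨i, i.2, rfl⟩
    · rintro ⟨i, hi, rfl⟩; exact ⟨⟨i, hi⟩, rfl⟩

lemma til_of_spans {k n : ℕ} {G : SimpleGraph (Fin n)} {S : Finset (Fin n)}
    (h : SpansCopy (SimpleGraph.cycleGraph k) G S) : Til k G S :=
  ⟨{S}, ⟨by simpa using h, by simp⟩, by simp⟩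

lemma spans_cycle {k n : ℕ} (hk : 2 ≤ k) {G : SimpleGraph (Fin n)} (c : Fin n) (l : List (Fin n))
    (hL : l.length + 1 = k) (hn : l.Nodup) (hcl : c ∉ l) (hc : l.IsChain G.Adj)
    (h1 : ∀ x ∈ l.head?, G.Adj c x) (h2 : ∀ x ∈ l.getLast?, G.Adj c x) :
    SpansCopy (SimpleGraph.cycleGraph k) G (insert c l.toFinset) := by
  have := spans_list hk (G := G) (c :: l) (by simpa using hL) (List.nodup_cons.2 ⟨hcl, hn⟩)
    (List.isChain_cons.2 ⟨h1, hc⟩) (by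
      intro x hx y hy
      simp only [List.head?_cons, Option.mem_def, Option.some.injEq] at hx
      subst hx
      have hne : l ≠ [] := by rintro rfl; simp at hL; omega
      rw [List.getLast?_cons_of_ne_nil hne] at hy
      exact (h2 y hy).symm)
  simpa using this

/-- large sets have an edge -/
def Hole {n : ℕ} (G : SimpleGraph (Fin n)) (a : ℕ) : Prop :=
  ∀ A B : Finset (Fin n), Disjoint A B → a ≤ A.card → a ≤ B.card → ∃ x ∈ A, ∃ y ∈ B, G.Adj x y

lemma path_aux {n : ℕ} {G : SimpleGraph (Fin n)} {a : ℕ} (hole : Hole G a)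
    (Xs : List (Finset (Fin n))) : ∀ X : Finset (Fin n),
    (∀ Y ∈ X :: Xs, 2 * a * (Xs.length + 1) ≤ Y.card) →
    ∃ E ⊆ X, a ≤ E.card ∧ ∀ e ∈ E, ∃ l : List (Fin n),
      List.Forall₂ (fun x Y => x ∈ Y) (e :: l) (X :: Xs) ∧ (e :: l).Nodup ∧
      (e :: l).IsChain G.Adj := by
  suffices H : ∀ (m : ℕ) (Xs : List (Finset (Fin n))), Xs.length = m → ∀ X : Finset (Fin n),
    (∀ Y ∈ X :: Xs, 2 * a * (Xs.length + 1) ≤ Y.card) →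
    ∃ E ⊆ X, a ≤ E.card ∧ ∀ e ∈ E, ∃ l : List (Fin n),
      List.Forall₂ (fun x Y => x ∈ Y) (e :: l) (X :: Xs) ∧ (e :: l).Nodup ∧
      (e :: l).IsChain G.Adj from H _ Xs rfl
  intro m
  induction m with
  | zero =>
    intro Xs hXs X h
    obtain rfl := List.length_eq_zero_iff.1 hXs
    refine ⟨X, subset_rfl, ?_, fun e he => ⟨[], by simpa using he, by simp, by simp⟩⟩
    have := h X (by simp)
    simp at this
    omega
  | succ m ih =>
    intro Xs hXs X h
    match Xs, hXs with
    | X' :: Xs, hXs =>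
    simp only [List.length_cons] at hXs h
    obtain ⟨Y, hYX, hY⟩ : ∃ Y ⊆ X, Y.card = 2 * a := by
      apply Finset.exists_subset_card_eq
      refine le_trans ?_ (h X (by simp))
      nlinarith
    obtain ⟨E, hE, hEc, hEl⟩ := ih (Xs.map (· \ Y)) (by simpa using hXs) (X' \ Y) (by
      have : ∀ Z ∈ X' :: Xs, 2 * a * (Xs.length + 1) ≤ (Z \ Y).card := by
        intro Z hZ
        have h1 := h Z (List.mem_cons_of_mem _ hZ)
        have h2 := Finset.le_card_sdiff Y Z
        rw [hY] at h2
        have : 2 * a * (Xs.length + 1 + 1) = 2 * a * (Xs.length + 1) + 2 * a := by ring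
        omega
      intro Z hZ
      rw [List.length_map]
      rw [List.mem_cons, List.mem_map] at hZ
      rcases hZ with rfl | ⟨Z, hZ, rfl⟩
      · exact this _ (by simp)
      · exact this _ (List.mem_cons_of_mem _ hZ))
    classical
    have hlt : (Y.filter (fun y => ¬ ∃ e ∈ E, G.Adj y e)).card < a := by
      by_contra hcon
      rw [not_lt] at hcon
      obtain ⟨x, hx, y, hy, hxy⟩ := hole (Y.filter (fun y => ¬ ∃ e ∈ E, G.Adj y e)) E (by
        rw [Finset.disjoint_left]
        intro z hz hz'
        exact (Finset.mem_sdiff.1 (hE hz')).2 (Finset.mem_filter.1 hz).1) hcon hEc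
      exact (Finset.mem_filter.1 hx).2 ⟨y, hy, hxy⟩
    refine ⟨Y.filter (fun y => ∃ e ∈ E, G.Adj y e), (Finset.filter_subset _ _).trans hYX, ?_, ?_⟩
    · have := Finset.card_filter_add_card_filter_not (s := Y) (fun y => ∃ e ∈ E, G.Adj y e)
      omega
    · intro y hy
      obtain ⟨hyY, e, he, hye⟩ := Finset.mem_filter.1 hy
      obtain ⟨l, hl1, hl2, hl3⟩ := hEl e he
      have hl1' : List.Forall₂ (fun x Z => x ∈ Z \ Y) (e :: l) (X' :: Xs) := by
        have : X' \ Y :: Xs.map (· \ Y) = (X' :: Xs).map (· \ Y) := by simp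
        rw [this, List.forall₂_map_right_iff] at hl1
        exact hl1
      refine ⟨e :: l, ?_, ?_, ?_⟩
      · refine List.Forall₂.cons (hYX hyY) (hl1'.imp fun x Z hx => (Finset.mem_sdiff.1 hx).1)
      · refine List.nodup_cons.2 ⟨fun hmem => ?_, hl2⟩
        have : ∀ (l : List (Fin n)) (Zs : List (Finset (Fin n))),
            List.Forall₂ (fun x Z => x ∈ Z \ Y) l Zs → ∀ x ∈ l, x ∉ Y := by
          intro l Zs h
          induction h with
          | nil => simp
          | cons h1 _ ih =>
            intro x hx
            rcases List.mem_cons.1 hx with rfl | hx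
            · exact (Finset.mem_sdiff.1 h1).2
            · exact ih x hx
        exact this _ _ hl1' y hmem hyY
      · rw [List.isChain_cons]
        refine ⟨?_, hl3⟩
        simpa using hye

lemma path_exists {n : ℕ} {G : SimpleGraph (Fin n)} {a : ℕ} (hole : Hole G a) (ha : 1 ≤ a)
    (W : Finset (Fin n)) (Xs : List (Finset (Fin n))) (hne : Xs ≠ [])
    (h : ∀ X ∈ Xs, 2 * a * Xs.length + W.card ≤ X.card) :
    ∃ l : List (Fin n), List.Forall₂ (fun x X => x ∈ X) l Xs ∧ l.Nodup ∧ l.IsChain G.Adj ∧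
      ∀ x ∈ l, x ∉ W := by
  match Xs, hne with
  | X :: Xs, _ =>
  obtain ⟨E, hE, hEc, hEl⟩ := path_aux hole (Xs.map (· \ W)) (X \ W) (by
    have : ∀ Z ∈ X :: Xs, 2 * a * (Xs.length + 1) ≤ (Z \ W).card := by
      intro Z hZ
      have h1 := h Z hZ
      have h2 := Finset.le_card_sdiff W Z
      rw [List.length_cons] at h1
      omega
    intro Z hZ
    rw [List.length_map]
    rw [List.mem_cons, List.mem_map] at hZ
    rcases hZ with rfl | ⟨Z, hZ, rfl⟩
    · exact this _ (by simp)
    · exact this _ (List.mem_cons_of_mem _ hZ))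
  obtain ⟨e, he⟩ := Finset.card_pos.1 (by omega : 0 < E.card)
  obtain ⟨l, hl1, hl2, hl3⟩ := hEl e he
  have hl1' : List.Forall₂ (fun x Z => x ∈ Z \ W) (e :: l) (X :: Xs) := by
    have : X \ W :: Xs.map (· \ W) = (X :: Xs).map (· \ W) := by simp
    rw [this, List.forall₂_map_right_iff] at hl1
    exact hl1
  have hW : ∀ (l : List (Fin n)) (Zs : List (Finset (Fin n))),
      List.Forall₂ (fun x Z => x ∈ Z \ W) l Zs → ∀ x ∈ l, x ∉ W := by
    intro l Zs h
    induction h with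
    | nil => simp
    | cons h1 _ ih =>
      intro x hx
      rcases List.mem_cons.1 hx with rfl | hx
      · exact (Finset.mem_sdiff.1 h1).2
      · exact ih x hx
  exact ⟨e :: l, hl1'.imp fun x Z hx => (Finset.mem_sdiff.1 hx).1, hl2, hl3, hW _ _ hl1'⟩

end RTT

namespace RTT

open Classical in
noncomputable def nb {n : ℕ} (G : SimpleGraph (Fin n)) (v : Fin n) : Finset (Fin n) :=
  Finset.univ.filter (fun w => G.Adj v w)

lemma mem_nb {n : ℕ} {G : SimpleGraph (Fin n)} {v w : Fin n} : w ∈ nb G v ↔ G.Adj v w := by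
  simp [nb]

lemma spans_card {k n : ℕ} {G : SimpleGraph (Fin n)} {S : Finset (Fin n)}
    (h : SpansCopy (SimpleGraph.cycleGraph k) G S) : S.card = k := by
  obtain ⟨f, hf, _, rfl⟩ := h
  rw [Finset.card_image_of_injective _ hf]; simp

lemma tiling_card {k n : ℕ} {G : SimpleGraph (Fin n)} {T : Finset (Finset (Fin n))}
    (h : IsTiling (SimpleGraph.cycleGraph k) G T) : (T.biUnion id).card = T.card * k := by
  rw [Finset.card_biUnion (t := id) (fun S hS S' hS' hne => h.2 S hS S' hS' hne)]
  exact Finset.sum_const_nat (fun S hS => spans_card (h.1 S hS))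

lemma til_dvd {k n : ℕ} {G : SimpleGraph (Fin n)} {A : Finset (Fin n)}
    (h : Til k G A) : k ∣ A.card := by
  obtain ⟨T, hT, rfl⟩ := h
  rw [tiling_card hT]; exact Dvd.intro_left _ rfl

lemma forall2_mem_replicate {n : ℕ} {l : List (Fin n)} {X : Finset (Fin n)} {m : ℕ}
    (h : List.Forall₂ (fun x X => x ∈ X) l (List.replicate m X)) : ∀ x ∈ l, x ∈ X := by
  induction m generalizing l with
  | zero =>
    simp at h; subst h; simp
  | succ m ih =>
    rw [List.replicate_succ] at h
    cases h with
    | cons h1 h2 =>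
      intro x hx
      rcases List.mem_cons.1 hx with rfl | hx
      · exact h1
      · exact ih h2 x hx

lemma center_cycle {k n : ℕ} (hk : 4 ≤ k) {G : SimpleGraph (Fin n)} {a : ℕ} (hole : Hole G a)
    (ha : 1 ≤ a) (c : Fin n) (X W : Finset (Fin n)) (hX : X ⊆ nb G c)
    (h : 2 * a * (k - 1) + W.card ≤ X.card) :
    ∃ Q : Finset (Fin n), SpansCopy (SimpleGraph.cycleGraph k) G (insert c Q) ∧ Q ⊆ X ∧
      Disjoint Q W ∧ Q.card = k - 1 := by
  obtain ⟨l, h1, h2, h3, h4⟩ := path_exists hole ha W (List.replicate (k - 1) X)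
    (by simp; omega) (by
      intro Y hY
      obtain rfl := List.eq_of_mem_replicate hY
      simpa using h)
  have hmem := forall2_mem_replicate h1
  have hlen := h1.length_eq
  rw [List.length_replicate] at hlen
  refine ⟨l.toFinset, spans_cycle (by omega) c l (by omega) h2 ?_ h3 ?_ ?_, ?_, ?_, ?_⟩
  · intro hc
    exact G.loopless.irrefl c (mem_nb.1 (hX (hmem c hc)))
  · intro x hx; exact mem_nb.1 (hX (hmem x (List.mem_of_mem_head? hx)))
  · intro x hx; exact mem_nb.1 (hX (hmem x (List.mem_of_mem_getLast? hx)))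
  · intro x hx; exact hmem x (List.mem_toFinset.1 hx)
  · rw [Finset.disjoint_left]; intro x hx; exact h4 x (List.mem_toFinset.1 hx)
  · rw [List.toFinset_card_of_nodup h2, hlen]

lemma sum_nb_inter {n : ℕ} (G : SimpleGraph (Fin n)) (U : Finset (Fin n)) :
    ∑ u ∈ U, (nb G u).card = ∑ v, (nb G v ∩ U).card := by
  classical
  have h1 : ∀ u, (nb G u).card = ∑ v, if G.Adj u v then 1 else 0 := by
    intro u; simp [nb]
  have h2 : ∀ v, (nb G v ∩ U).card = ∑ u ∈ U, if G.Adj u v then 1 else 0 := by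
    intro v
    rw [← Finset.card_filter]
    congr 1
    ext w
    simp [mem_nb, G.adj_comm, and_comm]
  simp only [h1, h2]
  rw [Finset.sum_comm]

lemma almost {k n : ℕ} (hk : 4 ≤ k) {G : SimpleGraph (Fin n)} {a : ℕ} (hole : Hole G a)
    (ha : 1 ≤ a) (A : Finset (Fin n)) (g D : ℕ) (hg : 2 * a * (k - 1) + k ≤ g)
    (hD : ∀ v, D ≤ (nb G v).card) :
    ∃ C : Finset (Fin n), Disjoint C A ∧ Til k G C ∧
      k * D * (univ \ (A ∪ C)).card ≤ (n + k * A.card) * (univ \ (A ∪ C)).card + k * n * g := by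
  classical
  obtain ⟨T, hT, hmax⟩ := Finset.exists_max_image
    (univ.filter (fun T : Finset (Finset (Fin n)) =>
      IsTiling (SimpleGraph.cycleGraph k) G T ∧ Disjoint (T.biUnion id) A)) Finset.card
    ⟨∅, Finset.mem_filter.2 ⟨Finset.mem_univ _, ⟨by simp, by simp⟩, by simp⟩⟩
  obtain ⟨hT, hTA⟩ := (Finset.mem_filter.1 hT).2
  refine ⟨T.biUnion id, hTA, ⟨T, hT, rfl⟩, ?_⟩
  set C := T.biUnion id with hC
  set U := univ \ (A ∪ C) with hU
  have hUA : Disjoint U A := by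
    rw [Finset.disjoint_left]; intro x hx hA
    simp [hU, hA] at hx
  have hUC : Disjoint U C := by
    rw [Finset.disjoint_left]; intro x hx hA
    simp [hU, hA] at hx
  -- adding a tile
  have hins : ∀ (T : Finset (Finset (Fin n))) (Q : Finset (Fin n)),
      IsTiling (SimpleGraph.cycleGraph k) G T → SpansCopy (SimpleGraph.cycleGraph k) G Q →
      (∀ S ∈ T, Disjoint Q S) →
      IsTiling (SimpleGraph.cycleGraph k) G (insert Q T) ∧ (insert Q T).card = T.card + 1 := by
    intro T Q hT hQ hd
    have hQT : Q ∉ T := by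
      intro h
      have := hd Q h
      rw [disjoint_self] at this
      have h2 := spans_card hQ
      rw [this] at h2
      simp at h2; omega
    refine ⟨⟨?_, ?_⟩, Finset.card_insert_of_notMem hQT⟩
    · intro S hS
      rcases Finset.mem_insert.1 hS with rfl | hS
      · exact hQ
      · exact hT.1 S hS
    · intro S hS S' hS' hne
      rcases Finset.mem_insert.1 hS with h1 | h1 <;> rcases Finset.mem_insert.1 hS' with h2 | h2
      · exact absurd (h1.trans h2.symm) hne
      · exact h1 ▸ hd _ h2
      · exact h2 ▸ (hd _ h1).symm
      · exact hT.2 S h1 S' h2 hne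
  have hSU : ∀ S ∈ T, Disjoint S U := fun S hS =>
    (Disjoint.mono_right (Finset.subset_biUnion_of_mem id hS) hUC).symm
  set R := univ.filter (fun v => g ≤ (nb G v ∩ U).card) with hR
  have hRU : ∀ v ∈ R, v ∉ U := by
    intro v hv hvU
    have hv := (Finset.mem_filter.1 hv).2
    obtain ⟨Q, hQ1, hQ2, hQ3, hQ4⟩ := center_cycle hk hole ha v (nb G v ∩ U) ∅
      Finset.inter_subset_left (by simp; omega)
    have hsub : insert v Q ⊆ U := by
      intro x hx
      rcases Finset.mem_insert.1 hx with rfl | hx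
      · exact hvU
      · exact (Finset.mem_inter.1 (hQ2 hx)).2
    obtain ⟨h1, h2⟩ := hins T _ hT hQ1 (fun S hS => ((hSU S hS).mono_right hsub).symm)
    have := hmax (insert (insert v Q) T) (by
      rw [Finset.mem_filter]
      refine ⟨Finset.mem_univ _, h1, ?_⟩
      rw [Finset.biUnion_insert, Finset.disjoint_union_left]
      exact ⟨hUA.mono_left hsub, hTA⟩)
    omega
  have hRS : ∀ S ∈ T, (R ∩ S).card ≤ 1 := by
    intro S hS
    rw [Finset.card_le_one]
    intro v hv w hw
    by_contra hne
    obtain ⟨hvR, hvS⟩ := Finset.mem_inter.1 hv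
    obtain ⟨hwR, hwS⟩ := Finset.mem_inter.1 hw
    have hvg := (Finset.mem_filter.1 hvR).2
    have hwg := (Finset.mem_filter.1 hwR).2
    obtain ⟨Q, hQ1, hQ2, hQ3, hQ4⟩ := center_cycle hk hole ha v (nb G v ∩ U) ∅
      Finset.inter_subset_left (by simp; omega)
    obtain ⟨Q', hQ1', hQ2', hQ3', hQ4'⟩ := center_cycle hk hole ha w (nb G w ∩ U) Q
      Finset.inter_subset_left (by omega)
    have hQU : Q ⊆ U := hQ2.trans Finset.inter_subset_right
    have hQU' : Q' ⊆ U := hQ2'.trans Finset.inter_subset_right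
    have hT' : IsTiling (SimpleGraph.cycleGraph k) G (T.erase S) :=
      ⟨fun S' hS' => hT.1 S' (Finset.mem_of_mem_erase hS'),
       fun S1 h1 S2 h2 => hT.2 S1 (Finset.mem_of_mem_erase h1) S2 (Finset.mem_of_mem_erase h2)⟩
    have hdv : ∀ x ∈ S, ∀ Q ⊆ U, ∀ S' ∈ T.erase S, Disjoint (insert x Q) S' := by
      intro x hx Q hQ S' hS'
      rw [Finset.disjoint_insert_left]
      have hS'' := Finset.mem_of_mem_erase hS'
      have := hT.2 S hS S' hS'' (Finset.ne_of_mem_erase hS').symm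
      exact ⟨Finset.disjoint_left.1 this hx, ((hSU S' hS'').mono_right hQ).symm⟩
    obtain ⟨h1, h2⟩ := hins (T.erase S) _ hT' hQ1 (hdv v hvS Q hQU)
    have hvU := hRU v hvR
    have hwU := hRU w hwR
    obtain ⟨h3, h4⟩ := hins _ _ h1 hQ1' (by
      intro S' hS'
      rcases Finset.mem_insert.1 hS' with rfl | hS'
      · rw [Finset.disjoint_insert_left, Finset.disjoint_insert_right, Finset.mem_insert]
        refine ⟨?_, fun h => hvU (hQU' h), hQ3'⟩
        rintro (h | h)
        · exact hne h.symm
        · exact hwU (hQU h)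
      · exact hdv w hwS Q' hQU' S' hS')
    have hA : ∀ x ∈ S, ∀ Q ⊆ U, Disjoint (insert x Q) A := by
      intro x hx Q hQ
      rw [Finset.disjoint_insert_left]
      exact ⟨Finset.disjoint_left.1 hTA (Finset.mem_biUnion.2 ⟨S, hS, hx⟩), hUA.mono_left hQ⟩
    have := hmax _ (by
      rw [Finset.mem_filter]
      refine ⟨Finset.mem_univ _, h3, ?_⟩
      rw [Finset.biUnion_insert, Finset.biUnion_insert, Finset.disjoint_union_left,
        Finset.disjoint_union_left]
      exact ⟨hA w hwS Q' hQU', hA v hvS Q hQU,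
        hTA.mono_left (Finset.biUnion_subset_biUnion_of_subset_left _ (Finset.erase_subset _ _))⟩)
    rw [h4, h2, Finset.card_erase_of_mem hS] at this
    have : 0 < T.card := Finset.card_pos.2 ⟨S, hS⟩
    omega
  have hRcard : R.card ≤ T.card + A.card := by
    have hsub : R ⊆ (T.biUnion (fun S => R ∩ S)) ∪ A := by
      intro v hv
      have h := hRU v hv
      simp only [hU, Finset.mem_sdiff, Finset.mem_univ, true_and, Finset.mem_union, not_not] at h
      rcases h with h | h
      · exact Finset.mem_union_right _ h
      · obtain ⟨S, hS, hvS⟩ := Finset.mem_biUnion.1 h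
        exact Finset.mem_union_left _ (Finset.mem_biUnion.2 ⟨S, hS, Finset.mem_inter.2 ⟨hv, hvS⟩⟩)
    refine (Finset.card_le_card hsub).trans ((Finset.card_union_le _ _).trans ?_)
    have := Finset.card_biUnion_le_card_mul T (fun S => R ∩ S) 1 hRS
    omega
  have hTk : T.card * k ≤ n := by
    rw [← tiling_card hT]
    simpa using Finset.card_le_univ (T.biUnion id)
  have hcount : D * U.card ≤ R.card * U.card + n * g := by
    calc D * U.card ≤ ∑ u ∈ U, (nb G u).card := by
          rw [mul_comm, ← smul_eq_mul]
          exact Finset.card_nsmul_le_sum _ _ _ (fun u _ => hD u)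
      _ = ∑ v, (nb G v ∩ U).card := sum_nb_inter G U
      _ ≤ ∑ v, ((if v ∈ R then U.card else 0) + g) := by
          apply Finset.sum_le_sum
          intro v _
          by_cases hv : v ∈ R
          · simp only [hv, if_true]
            have := Finset.card_le_card (Finset.inter_subset_right : nb G v ∩ U ⊆ U)
            omega
          · simp only [hv, if_false]
            simp only [hR, Finset.mem_filter, Finset.mem_univ, true_and, not_le] at hv
            omega
      _ = R.card * U.card + n * g := by
          rw [Finset.sum_add_distrib]
          simp
  calc k * D * U.card = k * (D * U.card) := by ring
    _ ≤ k * (R.card * U.card + n * g) := Nat.mul_le_mul_left _ hcount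
    _ ≤ k * ((T.card + A.card) * U.card + n * g) := by gcongr
    _ = (T.card * k + k * A.card) * U.card + k * n * g := by ring
    _ ≤ _ := by gcongr

end RTT

namespace RTT

/-- `P` can be completed to a cycle by any vertex of `X`. -/
def Sw (k : ℕ) {n : ℕ} (G : SimpleGraph (Fin n)) (P X : Finset (Fin n)) : Prop :=
  ∀ z ∈ X, z ∉ P → Til k G (insert z P)

lemma connP {k n : ℕ} (hk : 4 ≤ k) {G : SimpleGraph (Fin n)} {a : ℕ} (hole : Hole G a)
    (ha : 1 ≤ a) (W : Finset (Fin n)) (x y : Fin n) (hxy : x ≠ y) (hx : x ∉ W) (hy : y ∉ W)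
    (h : 2 * a * k + W.card + 2 ≤ (nb G x ∩ nb G y).card) :
    ∃ P : Finset (Fin n), Disjoint P W ∧ P.card = k - 1 ∧ Sw k G P (nb G x ∩ nb G y) := by
  obtain ⟨l, h1, h2, h3, h4⟩ := path_exists hole ha (insert x (insert y W))
    (List.replicate (k - 3) (nb G x ∩ nb G y))
    (by simp; omega) (by
      intro Y hY
      obtain rfl := List.eq_of_mem_replicate hY
      have c1 := Finset.card_insert_le x (insert y W)
      have c2 := Finset.card_insert_le y W
      have : 2 * a * (k - 3) ≤ 2 * a * k := Nat.mul_le_mul_left _ (by omega)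
      simp only [List.length_replicate]
      omega)
  have hmem := forall2_mem_replicate h1
  have hlen := h1.length_eq
  rw [List.length_replicate] at hlen
  have hxl : x ∉ l := fun hc => h4 x hc (by simp)
  have hyl : y ∉ l := fun hc => h4 y hc (by simp)
  have hnd : (x :: (l ++ [y])).Nodup := by
    rw [List.nodup_cons]
    refine ⟨by simp [hxl, hxy], ?_⟩
    rw [List.nodup_append]
    refine ⟨h2, by simp, ?_⟩
    intro u hu v hv
    simp at hv
    subst hv
    rintro rfl
    exact hyl hu
  have hchain : (x :: (l ++ [y])).IsChain G.Adj := by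
    rw [List.isChain_cons, List.isChain_append]
    refine ⟨?_, h3, by simp, ?_⟩
    · intro z hz
      have hne : l ≠ [] := by rintro rfl; simp at hlen; omega
      rw [List.head?_append_of_ne_nil _ hne] at hz
      exact mem_nb.1 (Finset.mem_inter.1 (hmem z (List.mem_of_mem_head? hz))).1
    · intro z hz w hw
      simp at hw
      subst hw
      exact (mem_nb.1 (Finset.mem_inter.1 (hmem z (List.mem_of_mem_getLast? hz))).2).symm
  refine ⟨(x :: (l ++ [y])).toFinset, ?_, ?_, ?_⟩
  · rw [Finset.disjoint_left]
    intro z hz hzW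
    simp only [List.mem_toFinset, List.mem_cons, List.mem_append, List.not_mem_nil, or_false] at hz
    rcases hz with rfl | hz | rfl
    · exact hx hzW
    · exact h4 z hz (by simp [hzW])
    · exact hy hzW
  · rw [List.toFinset_card_of_nodup hnd]
    simp
    omega
  · intro u hu huP
    rw [List.mem_toFinset] at huP
    obtain ⟨hu1, hu2⟩ := Finset.mem_inter.1 hu
    refine til_of_spans (spans_cycle (by omega) u _ (by simp; omega) hnd huP hchain ?_ ?_)
    · intro z hz
      simp at hz
      subst hz
      exact (mem_nb.1 hu1).symm
    · intro z hz
      rw [← List.cons_append, List.getLast?_append] at hz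
      simp at hz
      subst hz
      exact (mem_nb.1 hu2).symm

def bU {n : ℕ} : List (Finset (Fin n) × Finset (Fin n)) → Finset (Fin n)
  | [] => ∅
  | d :: D => d.1 ∪ bU D

lemma til_fold {k n : ℕ} {G : SimpleGraph (Fin n)}
    (D : List (Finset (Fin n) × Finset (Fin n))) (hS : ∀ d ∈ D, Sw k G d.1 d.2)
    (hd : D.Pairwise (fun d d' => Disjoint d.1 d'.1)) (l : List (Fin n))
    (hl : List.Forall₂ (fun x X => x ∈ X) l (D.map Prod.snd)) (hn : l.Nodup)
    (hlD : ∀ x ∈ l, x ∉ bU D) : Til k G (l.toFinset ∪ bU D) := by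
  induction D generalizing l with
  | nil =>
    simp at hl; subst hl
    simpa [bU] using til_empty k G
  | cons d D ih =>
    rw [List.map_cons] at hl
    cases hl with
    | @cons z _ l _ h1 h2 =>
    rw [List.pairwise_cons] at hd
    rw [List.nodup_cons] at hn
    have hI := ih (fun d' h => hS d' (List.mem_cons_of_mem _ h)) hd.2 l h2 hn.2 (by
      intro x hx h
      exact hlD x (List.mem_cons_of_mem _ hx) (by simp [bU, h]))
    have hz := hS d (by simp) z h1 (fun h => hlD z (by simp) (by simp [bU, h]))
    have hdD : ∀ D : List (Finset (Fin n) × Finset (Fin n)), (∀ d' ∈ D, Disjoint d.1 d'.1) →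
        Disjoint d.1 (bU D) := by
      intro D
      induction D with
      | nil => simp [bU]
      | cons e D ih =>
        intro h
        rw [bU, Finset.disjoint_union_right]
        exact ⟨h e (by simp), ih (fun d' h' => h d' (List.mem_cons_of_mem _ h'))⟩
    have hdis : Disjoint (insert z d.1) (l.toFinset ∪ bU D) := by
      rw [Finset.disjoint_insert_left, Finset.disjoint_union_right]
      refine ⟨?_, ?_, hdD D hd.1⟩
      · rw [Finset.mem_union, List.mem_toFinset]
        rintro (h | h)
        · exact hn.1 h
        · exact hlD z (by simp) (by simp [bU, h])
      · rw [Finset.disjoint_left]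
        intro x hx hxl
        exact hlD x (List.mem_cons_of_mem _ (List.mem_toFinset.1 hxl)) (by simp [bU, hx])
    have := til_union hz hI hdis
    convert this using 1
    ext x
    simp [bU]
    tauto

def C3 {n : ℕ} (G : SimpleGraph (Fin n)) (w g : ℕ) : Prop :=
  ∀ (c : Fin n) (W : Finset (Fin n)), W.card ≤ w → ∃ p q, p ∉ W ∧ q ∉ W ∧ p ≠ q ∧
    g ≤ (nb G p ∩ nb G q ∩ nb G c).card

def C4 {n : ℕ} (G : SimpleGraph (Fin n)) (w g : ℕ) : Prop :=
  ∀ (c : Fin n) (W : Finset (Fin n)), W.card ≤ w → ∃ p q, p ∉ W ∧ q ∉ W ∧ p ≠ q ∧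
    G.Adj c p ∧ G.Adj c q ∧ g ≤ (nb G p ∩ nb G q).card

lemma exists_D {k n : ℕ} (hk : 4 ≤ k) {G : SimpleGraph (Fin n)} {a w g : ℕ} (hole : Hole G a)
    (ha : 1 ≤ a) (h3 : C3 G w g) (hg : 2 * a * k + w + 2 ≤ g) (c : Fin n) (m : ℕ) :
    ∀ (W : Finset (Fin n)), W.card + m * k ≤ w →
    ∃ D : List (Finset (Fin n) × Finset (Fin n)), D.length = m ∧ (∀ d ∈ D, Sw k G d.1 d.2) ∧
      (∀ d ∈ D, d.2 ⊆ nb G c ∧ g ≤ d.2.card) ∧ D.Pairwise (fun d d' => Disjoint d.1 d'.1) ∧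
      Disjoint (bU D) W ∧ (bU D).card ≤ m * k := by
  induction m with
  | zero => intro W hW; exact ⟨[], by simp, by simp, by simp, by simp, by simp [bU], by simp [bU]⟩
  | succ m ih =>
    intro W hW
    have e : (m + 1) * k = m * k + k := by ring
    obtain ⟨p, q, hp, hq, hpq, hgc⟩ := h3 c W (by omega)
    have hsub := Finset.card_le_card (Finset.inter_subset_left :
      nb G p ∩ nb G q ∩ nb G c ⊆ nb G p ∩ nb G q)
    obtain ⟨P, hP1, hP2, hP3⟩ := connP hk hole ha W p q hpq hp hq (by omega)
    have hcu := Finset.card_union_le W P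
    obtain ⟨D, h1, h2, h3, h4, h5, h6⟩ := ih (W ∪ P) (by omega)
    rw [Finset.disjoint_union_right] at h5
    refine ⟨(P, nb G p ∩ nb G q ∩ nb G c) :: D, by simp [h1], ?_, ?_, ?_, ?_, ?_⟩
    · intro d hd
      rcases List.mem_cons.1 hd with rfl | hd
      · exact fun z hz => hP3 z (Finset.inter_subset_left hz)
      · exact h2 d hd
    · intro d hd
      rcases List.mem_cons.1 hd with rfl | hd
      · exact ⟨Finset.inter_subset_right, hgc⟩
      · exact h3 d hd
    · rw [List.pairwise_cons]
      refine ⟨?_, h4⟩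
      have : ∀ (D : List (Finset (Fin n) × Finset (Fin n))), ∀ d ∈ D, d.1 ⊆ bU D := by
        intro D
        induction D with
        | nil => simp
        | cons e D ih =>
          intro d hd
          rcases List.mem_cons.1 hd with rfl | hd
          · simp [bU]
          · exact (ih d hd).trans (by simp [bU])
      intro d hd
      exact (h5.2.mono_left (this D d hd)).symm
    · rw [bU, Finset.disjoint_union_left]
      exact ⟨hP1, h5.1⟩
    · rw [bU]
      have := Finset.card_union_le P (bU D)
      simp only
      omega

/-- gadget: takes any common neighbour of `x`, `y` and releases `t` -/
def Gad (k : ℕ) {n : ℕ} (G : SimpleGraph (Fin n)) (x y t : Fin n) (B : Finset (Fin n)) : Prop :=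
  t ∈ B ∧ Til k G B ∧ ∀ u, G.Adj x u → G.Adj y u → u ∉ B → Til k G (insert u (B.erase t))

lemma forall2_last {n : ℕ} {N : Finset (Fin n)} {l : List (Fin n)} {Xs : List (Finset (Fin n))}
    (h : List.Forall₂ (fun x X => x ∈ X) l Xs) (hX : ∀ X ∈ Xs, X ⊆ N) : ∀ x ∈ l, x ∈ N := by
  induction h with
  | nil => simp
  | cons h1 _ ih =>
    intro x hx
    rcases List.mem_cons.1 hx with rfl | hx
    · exact hX _ (by simp) h1
    · exact ih (fun X h => hX X (List.mem_cons_of_mem _ h)) x hx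

lemma path_center {k n : ℕ} (hk : 4 ≤ k) {G : SimpleGraph (Fin n)} {a : ℕ} (hole : Hole G a)
    (ha : 1 ≤ a) (c : Fin n) (W X F : Finset (Fin n)) (Xs : List (Finset (Fin n)))
    (hlen : Xs.length + 3 = k) (hX : X ⊆ nb G c) (hXs : ∀ Y ∈ Xs, Y ⊆ nb G c)
    (hc : c ∈ W) (h : ∀ Y ∈ X :: F :: Xs, 2 * a * k + W.card ≤ Y.card) :
    ∃ l : List (Fin n), List.Forall₂ (fun x X => x ∈ X) l (X :: F :: Xs) ∧ l.Nodup ∧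
      (∀ x ∈ l, x ∉ W) ∧ l.length = k - 1 ∧ Til k G (insert c l.toFinset) := by
  obtain ⟨l, h1, h2, h3, h4⟩ := path_exists hole ha W (X :: F :: Xs) (by simp) (by
    intro Y hY
    refine le_trans ?_ (h Y hY)
    gcongr
    simp
    omega)
  have hl := h1.length_eq
  simp only [List.length_cons] at hl
  refine ⟨l, h1, h2, h4, by omega, til_of_spans (spans_cycle (by omega) c l (by omega) h2
    (fun h => h4 c h hc) h3 ?_ ?_)⟩
  · intro z hz
    cases h1 with
    | cons h1 h2 =>
    simp at hz
    subst hz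
    exact mem_nb.1 (hX h1)
  · intro z hz
    cases h1 with
    | cons h1 h2 =>
    cases h2 with
    | @cons _ _ l _ h2 h3 =>
    have hne : l ≠ [] := by
      rintro rfl
      have := h3.length_eq
      simp at this hl; omega
    rw [List.getLast?_cons_of_ne_nil (by simp), List.getLast?_cons_of_ne_nil hne] at hz
    exact mem_nb.1 (forall2_last h3 hXs z (List.mem_of_mem_getLast? hz))

end RTT

namespace RTT

lemma gadget_fin {k n : ℕ} {G : SimpleGraph (Fin n)} (W Pu Pv Q : Finset (Fin n))
    (l l' : List (Fin n)) (c t x y : Fin n) (ht : t ∉ W)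
    (f1 : ∀ z ∈ Pu, z ∉ W ∧ z ≠ t) (f2 : ∀ z ∈ Pv, z ∉ W ∧ z ≠ t ∧ z ∉ Pu)
    (f3 : c ∉ W ∧ c ≠ t ∧ c ∉ Pu ∧ c ∉ Pv)
    (f4 : ∀ z ∈ Q, z ∉ W ∧ z ≠ t ∧ z ∉ Pu ∧ z ∉ Pv ∧ z ≠ c)
    (f5 : ∀ z ∈ l, z ∉ W ∧ z ≠ t ∧ z ∉ Pu ∧ z ∉ Pv ∧ z ≠ c ∧ z ∉ Q)
    (f6 : ∀ z ∈ l', z ∉ W ∧ z ≠ t ∧ z ∉ Pu ∧ z ∉ Pv ∧ z ≠ c ∧ z ∉ Q ∧ z ∉ l)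
    (F1 : Til k G (l.toFinset ∪ (Pu ∪ Q))) (F2 : Til k G (l'.toFinset ∪ (Pv ∪ Q)))
    (hl5 : Til k G (insert c l.toFinset)) (hl5' : Til k G (insert c l'.toFinset))
    (hPu3 : Sw k G Pu (nb G x ∩ nb G y)) (hPvt : Til k G (insert t Pv)) :
    Gad k G x y t ((insert t Pv ∪ (l.toFinset ∪ (Pu ∪ Q))) ∪ insert c l'.toFinset) ∧
    Disjoint ((insert t Pv ∪ (l.toFinset ∪ (Pu ∪ Q))) ∪ insert c l'.toFinset) W := by
  refine ⟨⟨?_, ?_, ?_⟩, ?_⟩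
  · simp
  · refine til_union (til_union hPvt F1 ?_) hl5' ?_
    · rw [Finset.disjoint_left]
      intro z hz hz'
      simp only [Finset.mem_insert, Finset.mem_union, List.mem_toFinset] at hz hz'
      replace f1 := f1 z; replace f2 := f2 z; replace f4 := f4 z; replace f5 := f5 z; replace f6 := f6 z; clear F1 F2 hl5 hl5' hPvt hPu3
      grind
    · rw [Finset.disjoint_left]
      intro z hz hz'
      simp only [Finset.mem_insert, Finset.mem_union, List.mem_toFinset] at hz hz'
      replace f1 := f1 z; replace f2 := f2 z; replace f4 := f4 z; replace f5 := f5 z; replace f6 := f6 z; clear F1 F2 hl5 hl5' hPvt hPu3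
      rcases hz' with rfl | hz'
      · grind
      · grind
  · intro u hxu hyu hu
    have hu' : u ≠ t ∧ u ∉ Pv ∧ u ∉ l ∧ u ∉ Pu ∧ u ∉ Q ∧ u ≠ c ∧ u ∉ l' := by
      simp only [Finset.mem_insert, Finset.mem_union, List.mem_toFinset] at hu
      grind
    have key : Til k G ((insert u Pu ∪ (l'.toFinset ∪ (Pv ∪ Q))) ∪ insert c l.toFinset) := by
      refine til_union (til_union (hPu3 u ?_ hu'.2.2.2.1) F2 ?_) hl5 ?_
      · rw [Finset.mem_inter, mem_nb, mem_nb]; exact ⟨hxu, hyu⟩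
      · rw [Finset.disjoint_left]
        intro z hz hz'
        simp only [Finset.mem_insert, Finset.mem_union, List.mem_toFinset] at hz hz'
        replace f1 := f1 z; replace f2 := f2 z; replace f4 := f4 z; replace f5 := f5 z; replace f6 := f6 z; clear F1 F2 hl5 hl5' hPvt hPu3
        rcases hz with rfl | hz
        · grind
        · grind
      · rw [Finset.disjoint_left]
        intro z hz hz'
        simp only [Finset.mem_insert, Finset.mem_union, List.mem_toFinset] at hz hz'
        replace f1 := f1 z; replace f2 := f2 z; replace f4 := f4 z; replace f5 := f5 z; replace f6 := f6 z; clear F1 F2 hl5 hl5' hPvt hPu3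
        rcases hz with (rfl | hz) | hz
        · grind
        · rcases hz' with rfl | hz' <;> grind
        · rcases hz' with rfl | hz' <;> grind
    convert key using 1
    ext z
    simp only [Finset.mem_insert, Finset.mem_union, List.mem_toFinset, Finset.mem_erase]
    replace f1 := f1 z; replace f2 := f2 z; replace f4 := f4 z; replace f5 := f5 z; replace f6 := f6 z; clear F1 F2 hl5 hl5' hPvt hPu3
    by_cases hzt : z = t
    · subst hzt
      have : z ≠ u := fun h => hu'.1 h.symm
      have : z ≠ c := fun h => f3.2.1 h.symm
      grind
    · grind
  · rw [Finset.disjoint_left]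
    intro z hz
    simp only [Finset.mem_insert, Finset.mem_union, List.mem_toFinset] at hz
    replace f1 := f1 z; replace f2 := f2 z; replace f4 := f4 z; replace f5 := f5 z; replace f6 := f6 z; clear F1 F2 hl5 hl5' hPvt hPu3
    rcases hz with ((rfl | hz) | hz | hz | hz) | rfl | hz <;> grind

set_option maxHeartbeats 1000000 in
lemma gadget {k n : ℕ} (hk : 4 ≤ k) {G : SimpleGraph (Fin n)} {a w g : ℕ} (hole : Hole G a)
    (ha : 1 ≤ a) (h3 : C3 G w g) (h4 : C4 G w g) (hg : 2 * a * k + w + 2 ≤ g) (hwn : w < n)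
    (W : Finset (Fin n)) (hW : W.card + 2 * (k * k) ≤ w) (x y t : Fin n)
    (hx : x ∉ W) (hy : y ∉ W) (ht : t ∉ W) (hxy : x ≠ y) (hxt : x ≠ t) (hyt : y ≠ t)
    (hgxy : g ≤ (nb G x ∩ nb G y).card) :
    ∃ B : Finset (Fin n), Gad k G x y t B ∧ Disjoint B W ∧ B.card ≤ 2 * (k * k) := by
  have hkk : 4 * k ≤ k * k := Nat.mul_le_mul_right _ hk
  have hk2 : (k - 2) * k + 2 * k = k * k := by
    rw [← add_mul]; congr 1; omega
  set W1 := insert t W with hW1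
  have cW1 : W1.card ≤ W.card + 1 := Finset.card_insert_le _ _
  obtain ⟨Pu, hPu1, hPu2, hPu3⟩ := connP hk hole ha W1 x y hxy (by simp [W1, hx, hxt])
    (by simp [W1, hy, hyt]) (by omega)
  set W2 := W1 ∪ Pu with hW2
  have cW2 : W2.card ≤ W1.card + Pu.card := Finset.card_union_le _ _
  obtain ⟨p, q, hp, hq, hpq, htp, htq, hgpq⟩ := h4 t W2 (by omega)
  obtain ⟨Pv, hPv1, hPv2, hPv3⟩ := connP hk hole ha W2 p q hpq hp hq (by omega)
  set W3 := W2 ∪ Pv with hW3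
  have cW3 : W3.card ≤ W2.card + Pv.card := Finset.card_union_le _ _
  obtain ⟨c, hc⟩ : ∃ c, c ∉ W3 := by
    by_contra hcon
    push Not at hcon
    have : W3 = univ := by ext z; simp [hcon]
    have h2 : W3.card = n := by rw [this]; simp
    omega
  set W4 := insert c W3 with hW4
  have cW4 : W4.card ≤ W3.card + 1 := Finset.card_insert_le _ _
  obtain ⟨D, hD1, hD2, hD3, hD4, hD5, hD6⟩ := exists_D hk hole ha h3 hg c (k - 2) W4 (by omega)
  obtain ⟨d, D', rfl⟩ : ∃ d D', D = d :: D' := by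
    cases D with
    | nil => simp at hD1; omega
    | cons d D => exact ⟨d, D, rfl⟩
  rename' D' => D
  set W5 := W4 ∪ bU (d :: D) with hW5
  have cW5 : W5.card ≤ W4.card + (bU (d :: D)).card := Finset.card_union_le _ _
  rw [List.length_cons] at hD1
  rw [List.pairwise_cons] at hD4
  have hXs : ∀ Y ∈ D.map Prod.snd, Y ⊆ nb G c ∧ g ≤ Y.card := by
    intro Y hY
    obtain ⟨e, he, rfl⟩ := List.mem_map.1 hY
    exact hD3 e (List.mem_cons_of_mem _ he)
  obtain ⟨l, hl1, hl2, hl3, hl4, hl5⟩ := path_center hk hole ha c W5 d.2 (nb G x ∩ nb G y)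
    (D.map Prod.snd) (by simp; omega) (hD3 d (by simp)).1 (fun Y hY => (hXs Y hY).1)
    (by simp [W5, W4]) (by
      intro Y hY
      have : g ≤ Y.card := by
        simp only [List.mem_cons] at hY
        rcases hY with rfl | rfl | hY
        · exact (hD3 d (by simp)).2
        · exact hgxy
        · exact (hXs Y hY).2
      omega)
  set W6 := W5 ∪ l.toFinset with hW6
  have cW6 : W6.card ≤ W5.card + l.toFinset.card := Finset.card_union_le _ _
  have cl := List.toFinset_card_le l
  obtain ⟨l', hl1', hl2', hl3', hl4', hl5'⟩ := path_center hk hole ha c W6 d.2 (nb G p ∩ nb G q)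
    (D.map Prod.snd) (by simp; omega) (hD3 d (by simp)).1 (fun Y hY => (hXs Y hY).1)
    (by simp [W6, W5, W4]) (by
      intro Y hY
      have : g ≤ Y.card := by
        simp only [List.mem_cons] at hY
        rcases hY with rfl | rfl | hY
        · exact (hD3 d (by simp)).2
        · exact hgpq
        · exact (hXs Y hY).2
      omega)
  have cl' := List.toFinset_card_le l'
  set Q := d.1 ∪ bU D with hQ
  have hbU : bU (d :: D) = Q := rfl
  rw [hbU] at hD5 hD6 hW5 cW5
  -- pointwise facts
  have f1 : ∀ z ∈ Pu, z ∉ W ∧ z ≠ t := by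
    intro z hz
    have := Finset.disjoint_left.1 hPu1 hz
    simp [W1] at this; tauto
  have f2 : ∀ z ∈ Pv, z ∉ W ∧ z ≠ t ∧ z ∉ Pu := by
    intro z hz
    have := Finset.disjoint_left.1 hPv1 hz
    simp [W2, W1] at this; tauto
  have f3 : c ∉ W ∧ c ≠ t ∧ c ∉ Pu ∧ c ∉ Pv := by
    have := hc
    simp [W3, W2, W1] at this; tauto
  have f4 : ∀ z ∈ Q, z ∉ W ∧ z ≠ t ∧ z ∉ Pu ∧ z ∉ Pv ∧ z ≠ c := by
    intro z hz
    have := Finset.disjoint_left.1 hD5 hz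
    simp [W4, W3, W2, W1] at this; tauto
  have f5 : ∀ z ∈ l, z ∉ W ∧ z ≠ t ∧ z ∉ Pu ∧ z ∉ Pv ∧ z ≠ c ∧ z ∉ Q := by
    intro z hz
    have := hl3 z hz
    simp only [hW5, W4, W3, W2, W1, Finset.mem_union, Finset.mem_insert] at this; tauto
  have f6 : ∀ z ∈ l', z ∉ W ∧ z ≠ t ∧ z ∉ Pu ∧ z ∉ Pv ∧ z ≠ c ∧ z ∉ Q ∧ z ∉ l := by
    intro z hz
    have := hl3' z hz
    simp only [W6, hW5, W4, W3, W2, W1, Finset.mem_union, Finset.mem_insert,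
      List.mem_toFinset] at this; tauto
  have hQd : ∀ e ∈ d :: D, e.1 ⊆ Q := by
    have : ∀ (D : List (Finset (Fin n) × Finset (Fin n))), ∀ d ∈ D, d.1 ⊆ bU D := by
      intro D
      induction D with
      | nil => simp
      | cons e D ih =>
        intro d hd
        rcases List.mem_cons.1 hd with rfl | hd
        · simp [bU]
        · exact (ih d hd).trans (by simp [bU])
    exact this (d :: D)
  -- folding
  have fold : ∀ (P F : Finset (Fin n)) (l : List (Fin n)), Sw k G P F → Disjoint P Q →
      List.Forall₂ (fun x X => x ∈ X) l (d.2 :: F :: D.map Prod.snd) → l.Nodup →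
      (∀ z ∈ l, z ∉ Q ∧ z ∉ P) → Til k G (l.toFinset ∪ (P ∪ Q)) := by
    intro P F l hP hPQ hl hn hlP
    have hb : bU (d :: (P, F) :: D) = P ∪ Q := by
      ext z; simp [bU, hQ]; tauto
    rw [← hb]
    apply til_fold
    · intro e he
      simp only [List.mem_cons] at he
      rcases he with rfl | rfl | he
      · exact hD2 _ (by simp)
      · exact hP
      · exact hD2 _ (List.mem_cons_of_mem _ he)
    · rw [List.pairwise_cons, List.pairwise_cons]
      refine ⟨?_, ?_, hD4.2⟩
      · intro e he
        rcases List.mem_cons.1 he with rfl | he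
        · exact (hPQ.mono_right (hQd d (by simp))).symm
        · exact hD4.1 e he
      · intro e he
        exact hPQ.mono_right (hQd e (List.mem_cons_of_mem _ he))
    · simpa using hl
    · exact hn
    · intro z hz
      rw [hb, Finset.mem_union]
      have := hlP z hz
      tauto
  have F1 := fold Pu _ l hPu3 (by
    rw [Finset.disjoint_left]; intro z hz hz'; exact (f4 z hz').2.2.1 hz) hl1 hl2
    (fun z hz => ⟨(f5 z hz).2.2.2.2.2, (f5 z hz).2.2.1⟩)
  have F2 := fold Pv _ l' hPv3 (by
    rw [Finset.disjoint_left]; intro z hz hz'; exact (f4 z hz').2.2.2.1 hz) hl1' hl2'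
    (fun z hz => ⟨(f6 z hz).2.2.2.2.2.1, (f6 z hz).2.2.2.1⟩)
  have hPvt : Til k G (insert t Pv) := hPv3 t
    (by rw [Finset.mem_inter, mem_nb, mem_nb]; exact ⟨htp.symm, htq.symm⟩)
    (by intro h; exact (f2 t h).2.1 rfl)
  obtain ⟨R1, R2⟩ := gadget_fin W Pu Pv Q l l' c t x y ht f1 f2 f3 f4 f5 f6 F1 F2 hl5 hl5' hPu3 hPvt
  refine ⟨(insert t Pv ∪ (l.toFinset ∪ (Pu ∪ Q))) ∪ insert c l'.toFinset, R1, R2, ?_⟩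
  · have b1 := Finset.card_union_le (insert t Pv ∪ (l.toFinset ∪ (Pu ∪ Q))) (insert c l'.toFinset)
    have b2 := Finset.card_union_le (insert t Pv) (l.toFinset ∪ (Pu ∪ Q))
    have b3 := Finset.card_union_le l.toFinset (Pu ∪ Q)
    have b4 := Finset.card_union_le Pu Q
    have b5 := Finset.card_insert_le t Pv
    have b6 := Finset.card_insert_le c l'.toFinset
    omega

end RTT

namespace RTT

lemma dc {n : ℕ} (G : SimpleGraph (Fin n)) (P S : Finset (Fin n)) :
    ∑ p ∈ P, ∑ q ∈ P, ((nb G p ∩ nb G q ∩ S).card : ℝ) = ∑ x ∈ S, ((nb G x ∩ P).card : ℝ) ^ 2 := by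
  classical
  have h1 : ∀ p q, ((nb G p ∩ nb G q ∩ S).card : ℝ) =
      ∑ x ∈ S, (if G.Adj x p then (1:ℝ) else 0) * (if G.Adj x q then (1:ℝ) else 0) := by
    intro p q
    have : nb G p ∩ nb G q ∩ S = S.filter (fun x => G.Adj x p ∧ G.Adj x q) := by
      ext z
      simp only [Finset.mem_inter, mem_nb, Finset.mem_filter, G.adj_comm z]
      tauto
    rw [this, Finset.card_filter]
    push_cast
    refine Finset.sum_congr rfl fun x _ => ?_
    by_cases hp : G.Adj x p <;> by_cases hq : G.Adj x q <;> simp [hp, hq]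
  have h2 : ∀ x, ((nb G x ∩ P).card : ℝ) = ∑ p ∈ P, (if G.Adj x p then (1:ℝ) else 0) := by
    intro x
    have : nb G x ∩ P = P.filter (fun p => G.Adj x p) := by
      ext z
      simp only [Finset.mem_inter, mem_nb, Finset.mem_filter]
      tauto
    rw [this, Finset.card_filter]
    push_cast
    rfl
  simp_rw [h1, h2, sq, Finset.sum_mul_sum]
  rw [Finset.sum_comm' (s := S) (t := fun _ => P) (t' := P) (s' := fun _ => S)]
  · refine Finset.sum_congr rfl fun p _ => ?_
    rw [Finset.sum_comm]
  · intro x y; tauto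

lemma good_pairs {n : ℕ} (f : Fin n → Fin n → ℕ) (P : Finset (Fin n)) (g : ℕ) (M : ℝ)
    (hf : ∀ p q, f p q ≤ n) (hM : M ≤ ∑ p ∈ P, ∑ q ∈ P, (f p q : ℝ)) :
    M - g * (P.card : ℝ) ^ 2 ≤ n * (((P ×ˢ P).filter (fun z => g ≤ f z.1 z.2)).card : ℝ) := by
  classical
  have h : ∑ p ∈ P, ∑ q ∈ P, (f p q : ℝ) ≤
      ∑ z ∈ P ×ˢ P, ((g : ℝ) + n * (if g ≤ f z.1 z.2 then 1 else 0)) := by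
    rw [← Finset.sum_product']
    refine Finset.sum_le_sum fun z _ => ?_
    split_ifs with hz
    · have : (f z.1 z.2 : ℝ) ≤ n := by exact_mod_cast hf _ _
      have : (0 : ℝ) ≤ g := by positivity
      linarith
    · have : (f z.1 z.2 : ℝ) ≤ g := by exact_mod_cast (by omega)
      linarith
  rw [Finset.sum_add_distrib, ← Finset.mul_sum] at h
  simp only [Finset.sum_const, Finset.card_product, nsmul_eq_mul] at h
  rw [Finset.card_filter]
  push_cast at h ⊢
  nlinarith [h]

lemma good_c {n : ℕ} (G : SimpleGraph (Fin n)) {η : ℝ} (hη : 0 < η) {g : ℕ}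
    (hd : ∀ v, η * n ≤ ((nb G v).card : ℝ)) (hg : (g : ℝ) ≤ η ^ 3 / 2 * n) (hn : 0 < n)
    (c : Fin n) :
    η ^ 3 / 2 * (n : ℝ) ^ 2 ≤ ((((univ : Finset (Fin n)) ×ˢ univ).filter
      (fun z => g ≤ (nb G z.1 ∩ nb G z.2 ∩ nb G c).card)).card : ℝ) := by
  have hn' : (0 : ℝ) < n := by exact_mod_cast hn
  have := good_pairs (fun p q => (nb G p ∩ nb G q ∩ nb G c).card) univ g (η ^ 3 * (n:ℝ) ^ 3)
    (fun p q => by simpa using Finset.card_le_univ (nb G p ∩ nb G q ∩ nb G c)) (by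
      rw [dc]
      have h1 : ∀ x ∈ nb G c, (η * n) ^ 2 ≤ ((nb G x ∩ univ).card : ℝ) ^ 2 := by
        intro x _
        rw [Finset.inter_univ]
        have := hd x
        gcongr
      have h2 := Finset.card_nsmul_le_sum _ _ _ h1
      rw [nsmul_eq_mul] at h2
      have h3 := mul_le_mul_of_nonneg_right (hd c) (sq_nonneg (η * n))
      calc _ = η * n * (η * n) ^ 2 := by ring
        _ ≤ _ := h3.trans h2)
  simp only [Finset.card_univ, Fintype.card_fin] at this
  have h4 : (g : ℝ) * n ^ 2 ≤ η ^ 3 / 2 * n * n ^ 2 := by gcongr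
  refine le_of_mul_le_mul_left ?_ hn'
  linarith

lemma good_u {n : ℕ} (G : SimpleGraph (Fin n)) {η : ℝ} (hη : 0 < η) (hη1 : η ≤ 1) {g : ℕ}
    (hd : ∀ v, η * n ≤ ((nb G v).card : ℝ)) (hg : (g : ℝ) ≤ η ^ 3 / 2 * n) (hn : 0 < n)
    (u : Fin n) :
    η ^ 4 / 2 * (n : ℝ) ^ 2 ≤ ((((nb G u) ×ˢ (nb G u)).filter
      (fun z => g ≤ (nb G z.1 ∩ nb G z.2).card)).card : ℝ) := by
  have hn' : (0 : ℝ) < n := by exact_mod_cast hn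
  set d : ℝ := ((nb G u).card : ℝ) with hdd
  have hd0 : 0 ≤ d := by positivity
  have := good_pairs (fun p q => (nb G p ∩ nb G q).card) (nb G u) g (η ^ 2 * (n:ℝ) * d ^ 2)
    (fun p q => by simpa using Finset.card_le_univ (nb G p ∩ nb G q)) (by
      have h0 := dc G (nb G u) univ
      simp only [Finset.inter_univ] at h0
      rw [h0]
      have h1 := sq_sum_le_card_mul_sum_sq (s := (univ : Finset (Fin n)))
        (f := fun x => ((nb G x ∩ nb G u).card : ℝ))
      have h2 : d * (η * n) ≤ ∑ x, ((nb G x ∩ nb G u).card : ℝ) := by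
        have := sum_nb_inter G (nb G u)
        have h3 : ∑ x, ((nb G x ∩ nb G u).card : ℝ) = ∑ x ∈ nb G u, ((nb G x).card : ℝ) := by
          exact_mod_cast this.symm
        rw [h3, hdd, ← nsmul_eq_mul]
        exact Finset.card_nsmul_le_sum _ _ _ (fun x _ => hd x)
      have h4 : (d * (η * n)) ^ 2 ≤ (∑ x, ((nb G x ∩ nb G u).card : ℝ)) ^ 2 := by
        gcongr
      simp only [Finset.card_univ, Fintype.card_fin] at h1
      refine le_of_mul_le_mul_left ?_ hn'
      calc _ = (d * (η * n)) ^ 2 := by ring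
        _ ≤ _ := h4.trans h1)
  have h4 : (g : ℝ) * d ^ 2 ≤ η ^ 3 / 2 * n * d ^ 2 := by gcongr
  have h5 : η ^ 3 ≤ η ^ 2 := by
    apply pow_le_pow_of_le_one hη.le hη1; norm_num
  have h6 : (η * n) ^ 2 ≤ d ^ 2 := by
    have := hd u
    gcongr
  have h7 : η ^ 3 / 2 * n * d ^ 2 ≤ η ^ 2 / 2 * n * d ^ 2 := by gcongr
  have h8 : (η ^ 2 / 2 * n) * (η * n) ^ 2 ≤ (η ^ 2 / 2 * n) * d ^ 2 := by gcongr
  refine le_of_mul_le_mul_left ?_ hn'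
  calc _ = (η ^ 2 / 2 * n) * (η * n) ^ 2 := by ring
    _ ≤ (η ^ 2 / 2 * n) * d ^ 2 := h8
    _ ≤ _ := by linarith

lemma avoid {n : ℕ} (T : Finset (Fin n × Fin n)) (W : Finset (Fin n))
    (h : (2 * W.card + 1) * n < T.card) : ∃ z ∈ T, z.1 ∉ W ∧ z.2 ∉ W ∧ z.1 ≠ z.2 := by
  classical
  by_contra hcon
  push Not at hcon
  have hsub : T ⊆ (W ×ˢ univ) ∪ (univ ×ˢ W) ∪ (univ : Finset (Fin n)).image (fun x => (x, x)) := by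
    intro z hz
    have := hcon z hz
    simp only [Finset.mem_union, Finset.mem_product, Finset.mem_univ, Finset.mem_image, true_and,
      and_true]
    by_cases h1 : z.1 ∈ W
    · exact Or.inl (Or.inl h1)
    by_cases h2 : z.2 ∈ W
    · exact Or.inl (Or.inr h2)
    · exact Or.inr ⟨z.1, Prod.ext rfl (this h1 h2)⟩
  have h1 := Finset.card_le_card hsub
  have h2 := Finset.card_union_le ((W ×ˢ univ) ∪ (univ ×ˢ W))
    ((univ : Finset (Fin n)).image (fun x => (x, x)))
  have h3 := Finset.card_union_le (W ×ˢ (univ : Finset (Fin n))) (univ ×ˢ W)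
  have h4 := Finset.card_image_le (s := (univ : Finset (Fin n))) (f := fun x => (x, x))
  simp only [Finset.card_product, Finset.card_univ, Fintype.card_fin] at h3 h4
  nlinarith

lemma c3_holds {n : ℕ} (G : SimpleGraph (Fin n)) {η : ℝ} (hη : 0 < η) {g w : ℕ}
    (hd : ∀ v, η * n ≤ ((nb G v).card : ℝ)) (hg : (g : ℝ) ≤ η ^ 3 / 2 * n) (hn : 0 < n)
    (hw : (2 * w + 1 : ℝ) < η ^ 3 / 2 * n) : C3 G w g := by
  intro c W hW
  have hn' : (0 : ℝ) < n := by exact_mod_cast hn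
  obtain ⟨z, hz, h1, h2, h3⟩ := avoid _ W (by
    have := good_c G hη hd hg hn c
    have h2 : ((2 * W.card + 1) * n : ℝ) < η ^ 3 / 2 * (n : ℝ) ^ 2 := by
      have : (W.card : ℝ) ≤ w := by exact_mod_cast hW
      calc ((2 * W.card + 1) * n : ℝ) ≤ (2 * w + 1) * n := by gcongr
        _ < η ^ 3 / 2 * n * n := by gcongr
        _ = _ := by ring
    exact_mod_cast h2.trans_le this)
  rw [Finset.mem_filter] at hz
  exact ⟨z.1, z.2, h1, h2, h3, hz.2⟩

lemma c4_holds {n : ℕ} (G : SimpleGraph (Fin n)) {η : ℝ} (hη : 0 < η) (hη1 : η ≤ 1) {g w : ℕ}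
    (hd : ∀ v, η * n ≤ ((nb G v).card : ℝ)) (hg : (g : ℝ) ≤ η ^ 3 / 2 * n) (hn : 0 < n)
    (hw : (2 * w + 1 : ℝ) < η ^ 4 / 2 * n) : C4 G w g := by
  intro c W hW
  have hn' : (0 : ℝ) < n := by exact_mod_cast hn
  obtain ⟨z, hz, h1, h2, h3⟩ := avoid _ W (by
    have := good_u G hη hη1 hd hg hn c
    have h2 : ((2 * W.card + 1) * n : ℝ) < η ^ 4 / 2 * (n : ℝ) ^ 2 := by
      have : (W.card : ℝ) ≤ w := by exact_mod_cast hW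
      calc ((2 * W.card + 1) * n : ℝ) ≤ (2 * w + 1) * n := by gcongr
        _ < η ^ 4 / 2 * n * n := by gcongr
        _ = _ := by ring
    exact_mod_cast h2.trans_le this)
  rw [Finset.mem_filter, Finset.mem_product, mem_nb, mem_nb] at hz
  exact ⟨z.1, z.2, h1, h2, h3, hz.1.1, hz.1.2, hz.2⟩

/-- valid triples -/
noncomputable def VT {n : ℕ} (G : SimpleGraph (Fin n)) (g : ℕ) (W : Finset (Fin n)) :
    Finset ((Fin n × Fin n) × Fin n) :=
  univ.filter (fun z => z.1.1 ∉ W ∧ z.1.2 ∉ W ∧ z.2 ∉ W ∧ z.1.1 ≠ z.1.2 ∧ z.1.1 ≠ z.2 ∧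
    z.1.2 ≠ z.2 ∧ g ≤ (nb G z.1.1 ∩ nb G z.1.2).card)

/-- the triple hits the pair -/
def Hit {n : ℕ} (G : SimpleGraph (Fin n)) (u v : Fin n) (x y t : Fin n) : Prop :=
  u ∈ nb G x ∧ u ∈ nb G y ∧ t ∈ nb G v

open Classical in
lemma triples {n : ℕ} (G : SimpleGraph (Fin n)) {η : ℝ} (hη : 0 < η) (hη1 : η ≤ 1) {g w : ℕ}
    (hd : ∀ v, η * n ≤ ((nb G v).card : ℝ)) (hg : (g : ℝ) ≤ η ^ 3 / 2 * n) (hn : 0 < n)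
    (hw : (3 * w + 3 : ℝ) ≤ η ^ 5 / 4 * n) (W : Finset (Fin n)) (hW : W.card ≤ w) (u v : Fin n) :
    η ^ 5 / 4 * (n : ℝ) ^ 3 ≤
      (((VT G g W).filter (fun z => Hit G u v z.1.1 z.1.2 z.2)).card : ℝ) := by
  have hn' : (0 : ℝ) < n := by exact_mod_cast hn
  set T := (((nb G u) ×ˢ (nb G u)).filter
      (fun z => g ≤ (nb G z.1 ∩ nb G z.2).card)) ×ˢ nb G v with hT
  have hTc : η ^ 5 / 2 * (n : ℝ) ^ 3 ≤ (T.card : ℝ) := by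
    rw [hT, Finset.card_product]
    push_cast
    calc _ = (η ^ 4 / 2 * (n:ℝ) ^ 2) * (η * n) := by ring
      _ ≤ _ := mul_le_mul (good_u G hη hη1 hd hg hn u) (hd v) (by positivity) (by positivity)
  have hsub : T ⊆ ((VT G g W).filter (fun z => Hit G u v z.1.1 z.1.2 z.2)) ∪
      ((((W ×ˢ univ) ×ˢ univ) ∪ ((univ ×ˢ W) ×ˢ univ) ∪ ((univ ×ˢ univ) ×ˢ W)) ∪
      (((univ : Finset (Fin n × Fin n)).image (fun z => ((z.1, z.1), z.2))) ∪
      ((univ : Finset (Fin n × Fin n)).image (fun z => ((z.1, z.2), z.1))) ∪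
      ((univ : Finset (Fin n × Fin n)).image (fun z => ((z.1, z.2), z.2))))) := by
    rintro ⟨⟨x, y⟩, t⟩ hz
    simp only [hT, Finset.mem_product, Finset.mem_filter] at hz
    obtain ⟨⟨⟨hx, hy⟩, hxy⟩, ht⟩ := hz
    simp only [Finset.mem_union, Finset.mem_product, Finset.mem_univ, Finset.mem_image, true_and,
      and_true]
    by_cases h1 : x ∈ W
    · exact Or.inr (Or.inl (Or.inl (Or.inl h1)))
    by_cases h2 : y ∈ W
    · exact Or.inr (Or.inl (Or.inl (Or.inr h2)))
    by_cases h3 : t ∈ W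
    · exact Or.inr (Or.inl (Or.inr h3))
    by_cases h4 : x = y
    · subst h4; exact Or.inr (Or.inr (Or.inl (Or.inl ⟨(x, t), rfl⟩)))
    by_cases h5 : x = t
    · subst h5; exact Or.inr (Or.inr (Or.inl (Or.inr ⟨(x, y), rfl⟩)))
    by_cases h6 : y = t
    · subst h6; exact Or.inr (Or.inr (Or.inr ⟨(x, y), rfl⟩))
    rw [mem_nb] at hx hy
    exact Or.inl (Finset.mem_filter.2 ⟨Finset.mem_filter.2 ⟨Finset.mem_univ _, h1, h2, h3, h4, h5,
      h6, hxy⟩, (mem_nb).2 hx.symm, (mem_nb).2 hy.symm, ht⟩)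
  have h1 := (Finset.card_le_card hsub).trans (Finset.card_union_le _ _)
  set H := ((VT G g W).filter (fun z => Hit G u v z.1.1 z.1.2 z.2)).card with hH
  have h2 := Finset.card_union_le
    ((((W ×ˢ (univ : Finset (Fin n))) ×ˢ (univ : Finset (Fin n))) ∪ ((univ ×ˢ W) ×ˢ univ) ∪
      ((univ ×ˢ univ) ×ˢ W)))
    (((univ : Finset (Fin n × Fin n)).image (fun z => ((z.1, z.1), z.2))) ∪
      ((univ : Finset (Fin n × Fin n)).image (fun z => ((z.1, z.2), z.1))) ∪
      ((univ : Finset (Fin n × Fin n)).image (fun z => ((z.1, z.2), z.2))))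
  have h3 := Finset.card_union_le
    (((W ×ˢ (univ : Finset (Fin n))) ×ˢ (univ : Finset (Fin n))) ∪ ((univ ×ˢ W) ×ˢ univ))
      ((univ ×ˢ univ) ×ˢ W)
  have h4 := Finset.card_union_le
    ((W ×ˢ (univ : Finset (Fin n))) ×ˢ (univ : Finset (Fin n))) ((univ ×ˢ W) ×ˢ univ)
  have h5 := Finset.card_union_le (((univ : Finset (Fin n × Fin n)).image
      (fun z => ((z.1, z.1), z.2))) ∪
      ((univ : Finset (Fin n × Fin n)).image (fun z => ((z.1, z.2), z.1))))
      ((univ : Finset (Fin n × Fin n)).image (fun z => ((z.1, z.2), z.2)))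
  have h6 := Finset.card_union_le ((univ : Finset (Fin n × Fin n)).image
      (fun z => ((z.1, z.1), z.2)))
      ((univ : Finset (Fin n × Fin n)).image (fun z => ((z.1, z.2), z.1)))
  have i1 := Finset.card_image_le (s := (univ : Finset (Fin n × Fin n)))
    (f := fun z => ((z.1, z.1), z.2))
  have i2 := Finset.card_image_le (s := (univ : Finset (Fin n × Fin n)))
    (f := fun z => ((z.1, z.2), z.1))
  have i3 := Finset.card_image_le (s := (univ : Finset (Fin n × Fin n)))
    (f := fun z => ((z.1, z.2), z.2))
  simp only [Finset.card_product, Finset.card_univ, Fintype.card_fin, Fintype.card_prod]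
    at h3 h4 i1 i2 i3
  have e1 : W.card * n * n ≤ w * n * n := by gcongr
  have e2 : n * W.card * n ≤ w * n * n := by nlinarith
  have e3 : n * n * W.card ≤ w * n * n := by nlinarith
  have key : T.card ≤ H + (3 * w + 3) * n * n := by nlinarith
  have key' : (T.card : ℝ) ≤ H + (3 * w + 3) * n * n := by exact_mod_cast key
  have : (3 * w + 3 : ℝ) * n * n ≤ η ^ 5 / 4 * n * n * n := by gcongr
  nlinarith

end RTT

namespace RTT

open Classical in
lemma avg {P T : Type*} [Fintype P] [Nonempty P] (V : Finset T) (R : P → T → Prop) (φ : P → ℝ)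
    (hφ : ∀ p, 0 < φ p) (θ M : ℝ) (hθ : 0 < θ) (hM : 0 < M) (hV : (V.card : ℝ) ≤ M)
    (h : ∀ p, θ * M ≤ ((V.filter (fun τ => R p τ)).card : ℝ)) :
    ∃ τ ∈ V, θ * ∑ p, φ p ≤ ∑ p, φ p * (if R p τ then 1 else 0) := by
  by_contra hcon
  push Not at hcon
  have hΦ : 0 < ∑ p, φ p := Finset.sum_pos (fun p _ => hφ p) Finset.univ_nonempty
  have hne : V.Nonempty := by
    obtain ⟨p⟩ := ‹Nonempty P›
    have h1 := h p
    have h2 : 0 < θ * M := by positivity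
    have h3 : (0 : ℝ) < ((V.filter (fun τ => R p τ)).card : ℝ) := h2.trans_le h1
    have h4 : 0 < (V.filter (fun τ => R p τ)).card := by exact_mod_cast h3
    obtain ⟨z, hz⟩ := Finset.card_pos.1 h4
    exact ⟨z, (Finset.mem_filter.1 hz).1⟩
  have h1 : ∑ τ ∈ V, ∑ p, φ p * (if R p τ then (1:ℝ) else 0) < ∑ τ ∈ V, θ * ∑ p, φ p :=
    Finset.sum_lt_sum_of_nonempty hne hcon
  rw [Finset.sum_comm] at h1
  have h2 : ∀ p, φ p * (θ * M) ≤ ∑ τ ∈ V, φ p * (if R p τ then (1:ℝ) else 0) := by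
    intro p
    rw [← Finset.mul_sum]
    have := h p
    rw [Finset.card_filter] at this
    push_cast at this
    exact mul_le_mul_of_nonneg_left this (hφ p).le
  have h3 := Finset.sum_le_sum (s := univ) (fun p _ => h2 p)
  rw [← Finset.sum_mul] at h3
  rw [Finset.sum_const, nsmul_eq_mul] at h1
  have h4 : (V.card : ℝ) * (θ * ∑ p, φ p) ≤ M * (θ * ∑ p, φ p) := by gcongr
  nlinarith

/-- gadgets -/
abbrev Gd (n : ℕ) := ((Fin n × Fin n) × Fin n) × Finset (Fin n)

structure Fam {n : ℕ} (k : ℕ) (G : SimpleGraph (Fin n)) (F : Finset (Gd n)) : Prop where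
  gad : ∀ e ∈ F, Gad k G e.1.1.1 e.1.1.2 e.1.2 e.2
  disj : ∀ e ∈ F, ∀ f ∈ F, e ≠ f → Disjoint e.2 f.2

open Classical in
noncomputable def hits {n : ℕ} (G : SimpleGraph (Fin n)) (F : Finset (Gd n)) (u v : Fin n) :
    Finset (Gd n) := F.filter (fun e => Hit G u v e.1.1.1 e.1.1.2 e.1.2)

lemma family {k n : ℕ} (hk : 4 ≤ k) {G : SimpleGraph (Fin n)} {a w g : ℕ} (hole : Hole G a)
    (ha : 1 ≤ a) (h3 : C3 G w g) (h4 : C4 G w g) (hg : 2 * a * k + w + 2 ≤ g) (hwn : w < n)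
    {θ : ℝ} (hθ : 0 < θ)
    (htr : open Classical in ∀ W : Finset (Fin n), W.card ≤ w → ∀ u v, θ * (n : ℝ) ^ 3 ≤
      (((VT G g W).filter (fun z => Hit G u v z.1.1 z.1.2 z.2)).card : ℝ)) (m : ℕ)
    (hm : m * (2 * (k * k)) ≤ w) :
    ∃ F : Finset (Gd n), Fam k G F ∧ (F.biUnion Prod.snd).card ≤ m * (2 * (k * k)) ∧
      ∑ p : Fin n × Fin n, (1 / 2 : ℝ) ^ (hits G F p.1 p.2).card ≤
        (n : ℝ) ^ 2 * (1 - θ / 2) ^ m := by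
  classical
  induction m with
  | zero =>
    refine ⟨∅, ⟨by simp, by simp⟩, by simp, ?_⟩
    simp [hits, sq]
  | succ m ih =>
    rw [add_mul, one_mul] at hm
    obtain ⟨F, hF, hFc, hΦ⟩ := ih (by omega)
    set W := F.biUnion Prod.snd with hW
    have hn : 0 < n := by omega
    have hn' : (0 : ℝ) < n := by exact_mod_cast hn
    have : Nonempty (Fin n) := ⟨⟨0, hn⟩⟩
    obtain ⟨τ, hτ, hτ2⟩ := avg (P := Fin n × Fin n) (VT G g W)
      (fun p z => Hit G p.1 p.2 z.1.1 z.1.2 z.2)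
      (fun p => (1 / 2 : ℝ) ^ (hits G F p.1 p.2).card) (fun p => by positivity) θ ((n:ℝ) ^ 3) hθ
      (by positivity) (by
        have := Finset.card_le_univ (VT G g W)
        simp only [Fintype.card_prod, Fintype.card_fin] at this
        have h' : ((VT G g W).card : ℝ) ≤ n * n * n := by exact_mod_cast this
        linarith [h', pow_succ (n:ℝ) 2, sq (n:ℝ)]) (fun p => htr W (by omega) p.1 p.2)
    obtain ⟨⟨x, y⟩, t⟩ := τ
    obtain ⟨-, hx, hy, ht, hxy, hxt, hyt, hgxy⟩ := Finset.mem_filter.1 hτ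
    obtain ⟨B, hB1, hB2, hB3⟩ := gadget hk hole ha h3 h4 hg hwn W (by omega) x y t hx hy ht hxy hxt
      hyt hgxy
    have hdj : ∀ e ∈ F, Disjoint e.2 B := fun e he =>
      (hB2.mono_right (Finset.subset_biUnion_of_mem Prod.snd he)).symm
    have hnot : (((x, y), t), B) ∉ F := fun h => by
      have := hdj _ h
      rw [Finset.disjoint_left] at this
      exact this hB1.1 hB1.1
    refine ⟨insert (((x, y), t), B) F, ⟨?_, ?_⟩, ?_, ?_⟩
    · intro e he
      rcases Finset.mem_insert.1 he with rfl | he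
      · exact hB1
      · exact hF.gad e he
    · intro e he f hf hef
      rcases Finset.mem_insert.1 he with rfl | he <;> rcases Finset.mem_insert.1 hf with rfl | hf
      · exact absurd rfl hef
      · exact (hdj f hf).symm
      · exact hdj e he
      · exact hF.disj e he f hf hef
    · rw [Finset.biUnion_insert, ← hW]
      have := Finset.card_union_le B W
      rw [add_mul, one_mul]
      simp only
      omega
    · have hstep : ∀ p : Fin n × Fin n,
          (1 / 2 : ℝ) ^ (hits G (insert (((x, y), t), B) F) p.1 p.2).card =
          (1 / 2 : ℝ) ^ (hits G F p.1 p.2).card - 1 / 2 * ((1 / 2 : ℝ) ^ (hits G F p.1 p.2).card *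
            (if Hit G p.1 p.2 x y t then 1 else 0)) := by
        intro p
        by_cases hp : Hit G p.1 p.2 x y t
        · have : hits G (insert (((x, y), t), B) F) p.1 p.2 =
              insert (((x, y), t), B) (hits G F p.1 p.2) := by
            unfold hits
            rw [Finset.filter_insert, if_pos hp]
          have hnot' : (((x, y), t), B) ∉ hits G F p.1 p.2 :=
            fun h => hnot (Finset.mem_filter.1 h).1
          rw [this, Finset.card_insert_of_notMem hnot', if_pos hp, pow_succ]
          ring
        · have : hits G (insert (((x, y), t), B) F) p.1 p.2 = hits G F p.1 p.2 := by
            unfold hits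
            rw [Finset.filter_insert, if_neg hp]
          rw [this, if_neg hp]
          ring
      have hθ2 : θ ≤ 1 := by
        have h1 := htr ∅ (by simp) ⟨0, hn⟩ ⟨0, hn⟩
        have h2 := (Finset.card_filter_le (VT G g ∅)
          (fun z => Hit G ⟨0, hn⟩ ⟨0, hn⟩ z.1.1 z.1.2 z.2)).trans (Finset.card_le_univ (VT G g ∅))
        simp only [Fintype.card_prod, Fintype.card_fin] at h2
        have h' : (((VT G g ∅).filter (fun z => Hit G ⟨0, hn⟩ ⟨0, hn⟩ z.1.1 z.1.2 z.2)).card : ℝ)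
            ≤ n * n * n := by exact_mod_cast h2
        have h3 : θ * (n:ℝ) ^ 3 ≤ 1 * (n : ℝ) ^ 3 := by
          calc _ ≤ _ := h1
            _ ≤ _ := h'
            _ = _ := by ring
        exact le_of_mul_le_mul_right h3 (by positivity)
      simp only [hstep]
      rw [Finset.sum_sub_distrib, ← Finset.mul_sum]
      have h5 : (∑ p : Fin n × Fin n, (1 / 2 : ℝ) ^ (hits G F p.1 p.2).card) * (1 - θ / 2) ≤
          (n : ℝ) ^ 2 * (1 - θ / 2) ^ m * (1 - θ / 2) :=
        mul_le_mul_of_nonneg_right hΦ (by linarith)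
      rw [pow_succ (1 - θ / 2)]
      simp only at hτ2
      linarith

end RTT

namespace RTT

lemma fam_til {k n : ℕ} {G : SimpleGraph (Fin n)} (F : Finset (Gd n)) (hF : Fam k G F) :
    Til k G (F.biUnion Prod.snd) := by
  classical
  induction F using Finset.induction_on with
  | empty => simpa using til_empty k G
  | insert e F he ih =>
    rw [Finset.biUnion_insert]
    refine til_union (hF.gad e (Finset.mem_insert_self _ _)).2.1 (ih ⟨?_, ?_⟩) ?_
    · intro f hf; exact hF.gad f (Finset.mem_insert_of_mem hf)
    · intro f hf f' hf' h
      exact hF.disj f (Finset.mem_insert_of_mem hf) f' (Finset.mem_insert_of_mem hf') h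
    · rw [Finset.disjoint_biUnion_right]
      intro f hf
      exact hF.disj e (Finset.mem_insert_self _ _) f (Finset.mem_insert_of_mem hf)
        (fun h => he (h ▸ hf))

lemma fam_eq {k n : ℕ} {G : SimpleGraph (Fin n)} {F : Finset (Gd n)} (hF : Fam k G F)
    {e f : Gd n} (he : e ∈ F) (hf : f ∈ F) {z : Fin n} (h1 : z ∈ e.2) (h2 : z ∈ f.2) : e = f := by
  by_contra h
  exact Finset.disjoint_left.1 (hF.disj e he f hf h) h1 h2

lemma rep {k n : ℕ} {G : SimpleGraph (Fin n)} {F : Finset (Gd n)} (hF : Fam k G F)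
    (L : List (Gd n × Fin n)) (h1 : ∀ p ∈ L, p.1 ∈ F) (h2 : (L.map Prod.fst).Nodup)
    (h3 : (L.map Prod.snd).Nodup)
    (h4 : ∀ p ∈ L, p.2 ∈ nb G p.1.1.1.1 ∧ p.2 ∈ nb G p.1.1.1.2)
    (h5 : ∀ p ∈ L, ∀ e ∈ F, p.2 ∉ e.2) :
    ∃ T, Til k G T ∧ ∀ z, z ∈ T ↔ ((∃ p ∈ L, z ∈ p.1.2 ∧ z ≠ p.1.1.2) ∨ ∃ p ∈ L, z = p.2) := by
  classical
  induction L with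
  | nil => exact ⟨∅, til_empty k G, by simp⟩
  | cons q L ih =>
    rw [List.map_cons, List.nodup_cons] at h2 h3
    obtain ⟨T, hT, hT2⟩ := ih (fun p hp => h1 p (List.mem_cons_of_mem _ hp)) h2.2 h3.2
      (fun p hp => h4 p (List.mem_cons_of_mem _ hp)) (fun p hp => h5 p (List.mem_cons_of_mem _ hp))
    have hq := h1 q List.mem_cons_self
    have hq4 := h4 q List.mem_cons_self
    have hq5 := h5 q List.mem_cons_self
    refine ⟨insert q.2 (q.1.2.erase q.1.1.2) ∪ T, til_union ((hF.gad _ hq).2.2 q.2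
      (mem_nb.1 hq4.1) (mem_nb.1 hq4.2) (hq5 _ hq)) hT ?_, ?_⟩
    · rw [Finset.disjoint_left]
      intro z hz hz'
      rw [hT2] at hz'
      rw [Finset.mem_insert, Finset.mem_erase] at hz
      rcases hz with rfl | ⟨_, hz⟩ <;> rcases hz' with ⟨p, hp, hzp, _⟩ | ⟨p, hp, hzp⟩
      · exact hq5 _ (h1 p (List.mem_cons_of_mem _ hp)) hzp
      · exact h3.1 (List.mem_map.2 ⟨p, hp, hzp.symm⟩)
      · have := fam_eq hF hq (h1 p (List.mem_cons_of_mem _ hp)) hz hzp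
        exact h2.1 (List.mem_map.2 ⟨p, hp, this.symm⟩)
      · subst hzp
        exact h5 p (List.mem_cons_of_mem _ hp) _ hq hz
    · intro z
      rw [Finset.mem_union, hT2, Finset.mem_insert, Finset.mem_erase]
      simp only [List.mem_cons, exists_eq_or_imp]
      constructor
      · rintro ((h | h) | h | h)
        · exact Or.inr (Or.inl h)
        · exact Or.inl (Or.inl h.symm)
        · exact Or.inl (Or.inr h)
        · exact Or.inr (Or.inr h)
      · rintro ((h | h) | h | h)
        · exact Or.inl (Or.inr h.symm)
        · exact Or.inr (Or.inl h)
        · exact Or.inl (Or.inl h)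
        · exact Or.inr (Or.inr h)

open Classical in
lemma pick {n : ℕ} (X : Fin n → Finset (Gd n)) (l us : List (Fin n))
    (h : List.Forall₂ (fun x u => x ∈ (X u).image (fun e => e.1.2)) l us) :
    ∃ L : List (Gd n × Fin n), L.map Prod.snd = us ∧ L.map (fun p => p.1.1.2) = l ∧
      ∀ p ∈ L, p.1 ∈ X p.2 := by
  induction h with
  | nil => exact ⟨[], by simp⟩
  | cons hx _ ih =>
    obtain ⟨L, h1, h2, h3⟩ := ih
    obtain ⟨e, he, rfl⟩ := Finset.mem_image.1 hx
    rename_i u _ _ _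
    refine ⟨(e, u) :: L, by simp [h1], by simp [h2], ?_⟩
    intro p hp
    rcases List.mem_cons.1 hp with rfl | hp
    · exact he
    · exact h3 p hp

lemma absorb {k n : ℕ} (hk : 4 ≤ k) {G : SimpleGraph (Fin n)} {a : ℕ} (hole : Hole G a)
    (ha : 1 ≤ a) (j : ℕ) : ∀ (U : Finset (Fin n)) (F : Finset (Gd n)), Fam k G F →
    U.card = k * j → Disjoint U (F.biUnion Prod.snd) →
    (∀ u v, k * j + (2 * a * (k - 1) + 1) ≤ (hits G F u v).card) →
    Til k G (F.biUnion Prod.snd ∪ U) := by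
  classical
  induction j with
  | zero =>
    intro U F hF hU _ _
    rw [mul_zero, Finset.card_eq_zero] at hU
    rw [hU, Finset.union_empty]
    exact fam_til F hF
  | succ j ih =>
    intro U F hF hU hUF hh
    rw [mul_add, mul_one] at hU hh
    obtain ⟨U', hU'1, hU'2⟩ := Finset.exists_subset_card_eq (s := U) (n := k) (by omega)
    obtain ⟨u1, us, hus⟩ : ∃ u us, U'.toList = u :: us := by
      cases h : U'.toList with
      | nil =>
        have := congrArg List.length h
        simp at this
        subst this
        simp at hU'2
        omega
      | cons u us => exact ⟨u, us, rfl⟩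
    have husl : us.length + 1 = k := by
      have := congrArg List.length hus
      simp at this
      omega
    have husn : (u1 :: us).Nodup := by rw [← hus]; exact U'.nodup_toList
    have husU' : ∀ z, z ∈ U' ↔ z ∈ u1 :: us := by intro z; rw [← hus, Finset.mem_toList]
    obtain ⟨e1, he1⟩ : (hits G F u1 u1).Nonempty := by
      rw [← Finset.card_pos]
      have := hh u1 u1
      omega
    obtain ⟨he1F, he1H⟩ := Finset.mem_filter.1 he1
    set c := e1.1.2 with hc
    set X : Fin n → Finset (Gd n) := fun u => (hits G F u c).erase e1 with hX
    have hXF : ∀ u, ∀ e ∈ X u, e ≠ e1 ∧ e ∈ F ∧ Hit G u c e.1.1.1 e.1.1.2 e.1.2 := by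
      intro u e he
      rw [hX, Finset.mem_erase] at he
      exact ⟨he.1, Finset.mem_filter.1 he.2⟩
    have htB : ∀ e ∈ F, e.1.2 ∈ e.2 := fun e he => (hF.gad e he).1
    have hinj : ∀ e ∈ F, ∀ f ∈ F, e.1.2 = f.1.2 → e = f := by
      intro e he f hf h
      exact fam_eq hF he hf (htB e he) (h ▸ htB f hf)
    have hXc : ∀ u, 2 * a * (k - 1) ≤ ((X u).image (fun e => e.1.2)).card := by
      intro u
      rw [Finset.card_image_of_injOn]
      · have h1 := Finset.pred_card_le_card_erase (s := hits G F u c) (a := e1)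
        have h2 := hh u c
        simp only [hX]
        omega
      · intro e he f hf h
        exact hinj e (hXF u e he).2.1 f (hXF u f hf).2.1 h
    obtain ⟨l, hl1, hl2, hl3, -⟩ := path_exists hole ha ∅
      (us.map (fun u => (X u).image (fun e => e.1.2)))
      (by intro h; have := congrArg List.length h; simp at this; subst this; simp at husl; omega)
      (by
        intro Y hY
        obtain ⟨u, _, rfl⟩ := List.mem_map.1 hY
        have := hXc u
        have h2 : us.length = k - 1 := by omega
        simpa [h2] using this)
    rw [List.forall₂_map_right_iff] at hl1
    obtain ⟨L, hL1, hL2, hL3⟩ := pick X l us hl1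
    have hLX : ∀ p ∈ L, p.1 ≠ e1 ∧ p.1 ∈ F ∧ Hit G p.2 c p.1.1.1.1 p.1.1.1.2 p.1.1.2 :=
      fun p hp => hXF p.2 p.1 (hL3 p hp)
    have hlen : L.length = us.length := by rw [← hL1, List.length_map]
    have hlx : ∀ x ∈ l, G.Adj c x ∧ x ≠ c := by
      intro x hx
      rw [← hL2] at hx
      obtain ⟨p, hp, rfl⟩ := List.mem_map.1 hx
      have := mem_nb.1 (hLX p hp).2.2.2.2
      exact ⟨this, this.ne'⟩
    have hcyc : Til k G (insert c l.toFinset) := by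
      apply til_of_spans
      apply spans_cycle (by omega) c l
      · rw [← hL2, List.length_map, hlen]; exact husl
      · exact hl2
      · intro h; exact (hlx c h).2 rfl
      · exact hl3
      · intro x hx; exact (hlx x (List.mem_of_mem_head? hx)).1
      · intro x hx; exact (hlx x (List.mem_of_mem_getLast? hx)).1
    set L' := (e1, u1) :: L with hL'
    have hL'F : ∀ p ∈ L', p.1 ∈ F := by
      intro p hp
      rcases List.mem_cons.1 hp with rfl | hp
      · exact he1F
      · exact (hLX p hp).2.1
    have hL'snd : L'.map Prod.snd = u1 :: us := by simp [hL', hL1]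
    have hL'U : ∀ p ∈ L', p.2 ∈ U' := by
      intro p hp
      rw [husU', ← hL'snd]
      exact List.mem_map.2 ⟨p, hp, rfl⟩
    have hU'F : ∀ z ∈ U, ∀ e ∈ F, z ∉ e.2 := by
      intro z hz e he hze
      exact Finset.disjoint_left.1 hUF hz (Finset.mem_biUnion.2 ⟨e, he, hze⟩)
    have hfst : (L'.map Prod.fst).Nodup := by
      rw [hL', List.map_cons, List.nodup_cons]
      constructor
      · intro h
        obtain ⟨p, hp, hpe⟩ := List.mem_map.1 h
        exact (hLX p hp).1 hpe
      · rw [← hL2] at hl2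
        have : L.map (fun p => p.1.1.2) = (L.map Prod.fst).map (fun e => e.1.2) := by
          rw [List.map_map]; rfl
        rw [this] at hl2
        exact hl2.of_map _
    obtain ⟨T, hT1, hT2⟩ := rep hF L' hL'F hfst (by rw [hL'snd]; exact husn) (by
      intro p hp
      rcases List.mem_cons.1 hp with rfl | hp
      · exact ⟨he1H.1, he1H.2.1⟩
      · exact ⟨(hLX p hp).2.2.1, (hLX p hp).2.2.2.1⟩)
      (fun p hp => hU'F p.2 (hU'1 (hL'U p hp)))
    have hcycm : ∀ z, z ∈ insert c l.toFinset ↔ ∃ p ∈ L', z = p.1.1.2 := by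
      intro z
      rw [Finset.mem_insert, List.mem_toFinset, ← hL2, List.mem_map]
      simp only [hL', List.mem_cons, exists_eq_or_imp, ← hc]
      constructor
      · rintro (h | ⟨p, hp, rfl⟩)
        · exact Or.inl h
        · exact Or.inr ⟨p, hp, rfl⟩
      · rintro (h | ⟨p, hp, rfl⟩)
        · exact Or.inl h
        · exact Or.inr ⟨p, hp, rfl⟩
    set E := (L'.map Prod.fst).toFinset with hE
    have hEm : ∀ e, e ∈ E ↔ ∃ p ∈ L', p.1 = e := by
      intro e; rw [hE, List.mem_toFinset, List.mem_map]
    have hEc : E.card ≤ k := by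
      refine (List.toFinset_card_le _).trans ?_
      rw [List.length_map, hL', List.length_cons, hlen, husl]
    have hFE : Fam k G (F \ E) :=
      ⟨fun e he => hF.gad e (Finset.mem_sdiff.1 he).1,
        fun e he f hf => hF.disj e (Finset.mem_sdiff.1 he).1 f (Finset.mem_sdiff.1 hf).1⟩
    have hrec := ih (U \ U') (F \ E) hFE (by
        rw [Finset.card_sdiff_of_subset hU'1]; omega) (by
        rw [Finset.disjoint_left]
        intro z hz hz'
        obtain ⟨e, he, hze⟩ := Finset.mem_biUnion.1 hz'
        exact hU'F z (Finset.mem_sdiff.1 hz).1 e (Finset.mem_sdiff.1 he).1 hze) (by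
        intro u v
        have h1 : hits G F u v \ E ⊆ hits G (F \ E) u v := by
          intro e he
          rw [Finset.mem_sdiff] at he
          obtain ⟨h2, h3⟩ := Finset.mem_filter.1 he.1
          exact Finset.mem_filter.2 ⟨Finset.mem_sdiff.2 ⟨h2, he.2⟩, h3⟩
        have h2 := Finset.card_le_card h1
        have h3 := Finset.le_card_sdiff E (hits G F u v)
        have h4 := hh u v
        omega)
    have hcT : Til k G (insert c l.toFinset ∪ T) := by
      refine til_union hcyc hT1 ?_
      rw [Finset.disjoint_left]
      intro z hz hz'
      obtain ⟨p, hp, rfl⟩ := (hcycm z).1 hz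
      rcases (hT2 _).1 hz' with ⟨q, hq, h1, h2⟩ | ⟨q, hq, h1⟩
      · have := fam_eq hF (hL'F p hp) (hL'F q hq) (htB _ (hL'F p hp)) h1
        exact h2 (by rw [this])
      · exact hU'F q.2 (hU'1 (hL'U q hq)) p.1 (hL'F p hp) (h1 ▸ htB _ (hL'F p hp))
    have hbig : ∀ z, z ∈ insert c l.toFinset ∪ T ↔ ((∃ e ∈ E, z ∈ e.2) ∨ z ∈ U') := by
      intro z
      rw [Finset.mem_union, hcycm, hT2]
      constructor
      · rintro (⟨p, hp, rfl⟩ | ⟨p, hp, h1, -⟩ | ⟨p, hp, rfl⟩)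
        · exact Or.inl ⟨p.1, (hEm _).2 ⟨p, hp, rfl⟩, htB _ (hL'F p hp)⟩
        · exact Or.inl ⟨p.1, (hEm _).2 ⟨p, hp, rfl⟩, h1⟩
        · exact Or.inr (hL'U p hp)
      · rintro (⟨e, he, hz⟩ | hz)
        · obtain ⟨p, hp, rfl⟩ := (hEm e).1 he
          by_cases h : z = p.1.1.2
          · exact Or.inl ⟨p, hp, h⟩
          · exact Or.inr (Or.inl ⟨p, hp, hz, h⟩)
        · rw [husU', ← hL'snd, List.mem_map] at hz
          obtain ⟨p, hp, rfl⟩ := hz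
          exact Or.inr (Or.inr ⟨p, hp, rfl⟩)
    have hEF : ∀ e ∈ E, e ∈ F := by
      intro e he
      obtain ⟨p, hp, rfl⟩ := (hEm e).1 he
      exact hL'F p hp
    have hfin := til_union hrec hcT (by
      rw [Finset.disjoint_left]
      intro z hz hz'
      rw [hbig] at hz'
      rw [Finset.mem_union, Finset.mem_biUnion, Finset.mem_sdiff] at hz
      rcases hz with ⟨e, he, hze⟩ | ⟨hz1, hz2⟩
      · rw [Finset.mem_sdiff] at he
        rcases hz' with ⟨f, hf, hzf⟩ | hz'
        · exact he.2 (fam_eq hF he.1 (hEF f hf) hze hzf ▸ hf)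
        · exact hU'F z (hU'1 hz') e he.1 hze
      · rcases hz' with ⟨f, hf, hzf⟩ | hz'
        · exact hU'F z hz1 f (hEF f hf) hzf
        · exact hz2 hz')
    convert hfin using 1
    ext z
    rw [Finset.mem_union (s := _ ∪ _), hbig, Finset.mem_union, Finset.mem_union,
      Finset.mem_biUnion, Finset.mem_biUnion, Finset.mem_sdiff]
    constructor
    · rintro (⟨e, he, hz⟩ | hz)
      · by_cases h : e ∈ E
        · exact Or.inr (Or.inl ⟨e, h, hz⟩)
        · exact Or.inl (Or.inl ⟨e, Finset.mem_sdiff.2 ⟨he, h⟩, hz⟩)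
      · by_cases h : z ∈ U'
        · exact Or.inr (Or.inr h)
        · exact Or.inl (Or.inr ⟨hz, h⟩)
    · rintro ((⟨e, he, hz⟩ | hz) | ⟨e, he, hz⟩ | hz)
      · exact Or.inl ⟨e, (Finset.mem_sdiff.1 he).1, hz⟩
      · exact Or.inr hz.1
      · exact Or.inl ⟨e, hEF e he, hz⟩
      · exact Or.inr (hU'1 hz)

end RTT

namespace RTT

lemma hits_lower {n : ℕ} {G : SimpleGraph (Fin n)} (F : Finset (Gd n)) (θ : ℝ) (hθ1 : θ ≤ 1)
    (m : ℕ) (hn : 0 < n)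
    (h : ∑ p : Fin n × Fin n, (1 / 2 : ℝ) ^ (hits G F p.1 p.2).card ≤
        (n : ℝ) ^ 2 * (1 - θ / 2) ^ m) (u v : Fin n) :
    θ / 2 * m - 2 * Real.log n ≤ ((hits G F u v).card : ℝ) := by
  have hn' : (0 : ℝ) < n := by exact_mod_cast hn
  set s := (hits G F u v).card with hs
  have h1 : (1 / 2 : ℝ) ^ s ≤ (n : ℝ) ^ 2 * (1 - θ / 2) ^ m := by
    refine le_trans ?_ h
    exact Finset.single_le_sum (f := fun p : Fin n × Fin n =>
      (1 / 2 : ℝ) ^ (hits G F p.1 p.2).card) (fun p _ => by positivity) (Finset.mem_univ (u, v))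
  have h2 : Real.exp (-s) ≤ (1 / 2 : ℝ) ^ s := by
    have : Real.exp (-1) ≤ 1 / 2 := by
      rw [Real.exp_neg, one_div]
      have := Real.add_one_le_exp 1
      apply inv_anti₀ <;> linarith
    calc Real.exp (-s) = (Real.exp (-1)) ^ s := by rw [← Real.exp_nat_mul]; ring_nf
      _ ≤ _ := by gcongr
  have h3 : (1 - θ / 2) ^ m ≤ Real.exp (-(θ / 2 * m)) := by
    have : 1 - θ / 2 ≤ Real.exp (-(θ / 2)) := by
      have := Real.add_one_le_exp (-(θ / 2)); linarith
    calc (1 - θ / 2) ^ m ≤ (Real.exp (-(θ / 2))) ^ m := by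
          apply pow_le_pow_left₀ _ this; linarith
      _ = _ := by rw [← Real.exp_nat_mul]; ring_nf
  have h4 : (n : ℝ) ^ 2 = Real.exp (2 * Real.log n) := by
    rw [mul_comm, Real.exp_mul, Real.exp_log hn']
    norm_cast
  have h5 : Real.exp (-s) ≤ Real.exp (2 * Real.log n + -(θ / 2 * m)) := by
    rw [Real.exp_add, ← h4]
    refine h2.trans (h1.trans ?_)
    gcongr
  have := Real.exp_le_exp.1 h5
  linarith

set_option maxHeartbeats 1000000 in
lemma core {k n : ℕ} (hk : 4 ≤ k) (hkn : k ∣ n) {G : SimpleGraph (Fin n)} {a : ℕ}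
    (hole : Hole G a) (ha : 1 ≤ a) {η ε θ μ ρ α : ℝ} (hη0 : 0 < η) (hη1 : η ≤ 1) (hε : 0 < ε)
    (hεη : ε = η - 1 / k) (hθ : θ = η ^ 5 / 4) (hμ : μ = ε * η ^ 5 / 24)
    (hρ : ρ = θ * μ / (4 * k ^ 2)) (hα : α = ε * ρ / (32 * k)) (haα : (a : ℝ) ≤ α * n + 1)
    (hd : ∀ v, η * n ≤ ((nb G v).card : ℝ)) (hn : 0 < n)
    (E1 : 3 * (k : ℝ) ≤ ε * ρ / 16 * n) (E2 : 2 * Real.log n ≤ ρ / 4 * n) :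
    Til k G univ := by
  classical
  have hn' : (0 : ℝ) < n := by exact_mod_cast hn
  have hk' : (4 : ℝ) ≤ k := by exact_mod_cast hk
  have hk0 : (0 : ℝ) < k := by linarith
  have hε1 : ε ≤ 1 := by
    have : 0 < 1 / (k : ℝ) := by positivity
    linarith
  have hθ0 : 0 < θ := by rw [hθ]; positivity
  have hμ0 : 0 < μ := by rw [hμ]; positivity
  have hρ0 : 0 < ρ := by rw [hρ]; positivity
  have p1 : η ^ 5 ≤ η ^ 3 := pow_le_pow_of_le_one hη0.le hη1 (by norm_num)
  have p2 : η ^ 5 ≤ η ^ 4 := pow_le_pow_of_le_one hη0.le hη1 (by norm_num)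
  have p3 : η ^ 5 ≤ 1 := pow_le_one₀ hη0.le hη1
  have p4 : 0 < η ^ 5 := by positivity
  have hθ1 : θ ≤ 1 := by rw [hθ]; linarith
  have hμ1 : μ ≤ η ^ 5 / 24 := by rw [hμ]; nlinarith
  have hμ2 : μ ≤ ε / 2 := by rw [hμ]; nlinarith
  have hρ1 : ρ ≤ η ^ 5 / 24 := by
    rw [hρ, div_le_iff₀ (by positivity)]
    have : (1:ℝ) ≤ 4 * k ^ 2 := by nlinarith
    nlinarith
  have hρε : ε * ρ ≤ ρ := by nlinarith
  have h2kα : 2 * (k : ℝ) * α = ε * ρ / 16 := by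
    rw [hα]; field_simp; norm_num
  -- bound for a
  have hak : 2 * (a : ℝ) * k ≤ ε * ρ / 16 * n + 2 * k := by
    calc 2 * (a : ℝ) * k ≤ 2 * (α * n + 1) * k := by gcongr
      _ = (2 * k * α) * n + 2 * k := by ring
      _ = _ := by rw [h2kα]
  have q1 : ε * ρ / 16 * n ≤ η ^ 5 / 384 * n := by
    exact mul_le_mul_of_nonneg_right (by linarith) hn'.le
  have q2 : ε * ρ / 16 * n ≤ ρ / 16 * n := by
    gcongr
  set w := ⌊μ * n⌋₊ with hw
  have hwle : (w : ℝ) ≤ μ * n := Nat.floor_le (by positivity)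
  have hwlt : μ * n < w + 1 := Nat.lt_floor_add_one _
  have hμn : μ * n ≤ η ^ 5 / 24 * n := by gcongr
  set g := ⌊η ^ 3 / 2 * n⌋₊ with hg
  have hgle : (g : ℝ) ≤ η ^ 3 / 2 * n := Nat.floor_le (by positivity)
  have hglt : η ^ 3 / 2 * n < g + 1 := Nat.lt_floor_add_one _
  have q3 : η ^ 5 * n ≤ η ^ 3 * n := by gcongr
  have q4 : η ^ 5 * n ≤ η ^ 4 * n := by gcongr
  have q5 : η ^ 5 * n ≤ 1 * n := by gcongr
  have q6 : 0 < η ^ 5 * n := by positivity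
  have R1 : (3 * w + 3 : ℝ) ≤ η ^ 5 / 4 * n := by linarith
  have w0 : (0 : ℝ) ≤ w := by positivity
  have R2 : (2 * w + 1 : ℝ) < η ^ 3 / 2 * n := by linarith
  have R2' : (2 * w + 1 : ℝ) < η ^ 4 / 2 * n := by linarith
  have R3 : 2 * a * k + w + 2 ≤ g := by
    have : (2 * a * k + w + 2 : ℝ) < g + 1 := by linarith
    have : 2 * a * k + w + 2 < g + 1 := by exact_mod_cast this
    omega
  have R4 : w < n := by
    have : (w : ℝ) < n := by linarith
    exact_mod_cast this
  set m := w / (2 * (k * k)) with hm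
  have hm1 : m * (2 * (k * k)) ≤ w := Nat.div_mul_le_self _ _
  have hm2 : w < (m + 1) * (2 * (k * k)) := by
    rw [hm, add_mul, one_mul]
    exact Nat.lt_div_mul_add (by positivity)
  obtain ⟨F, hF, hFc, hFΦ⟩ := family hk hole ha (c3_holds G hη0 hd hgle hn R2)
    (c4_holds G hη0 hη1 hd hgle hn R2') R3 R4 hθ0
    (fun W hW u v => by rw [hθ]; exact triples G hη0 hη1 hd hgle hn R1 W hW u v) m hm1
  have hhits : ∀ u v, ρ / 2 * n ≤ ((hits G F u v).card : ℝ) := by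
    intro u v
    have h1 := hits_lower F θ hθ1 m hn hFΦ u v
    have h2 : (w : ℝ) + 1 ≤ (m + 1) * (2 * (k * k)) := by exact_mod_cast hm2
    have h3 : ρ * n ≤ θ / 2 * (m + 1) := by
      have h4 : μ * n ≤ (m + 1) * (2 * (k * k)) := by linarith
      calc ρ * n = θ / (4 * k ^ 2) * (μ * n) := by rw [hρ]; ring
        _ ≤ θ / (4 * k ^ 2) * ((m + 1) * (2 * (k * k))) := by gcongr
        _ = _ := by field_simp; ring
    linarith
  set A := F.biUnion Prod.snd with hA
  obtain ⟨C, hCA, hC, hCU⟩ := almost hk hole ha A (2 * a * (k - 1) + k) ⌈η * n⌉₊ le_rfl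
    (fun v => Nat.ceil_le.2 (hd v))
  set U := univ \ (A ∪ C) with hU
  have hAc : (A.card : ℝ) ≤ μ * n := by
    have : A.card ≤ w := hFc.trans hm1
    have : (A.card : ℝ) ≤ w := by exact_mod_cast this
    linarith
  have hk1 : 2 * a * (k - 1) ≤ 2 * a * k := by gcongr; omega
  have hk1' : ((2 * a * (k - 1) : ℕ) : ℝ) ≤ 2 * a * k := by exact_mod_cast hk1
  have hUc : (U.card : ℝ) ≤ ρ / 4 * n := by
    have h1 : (k : ℝ) * ⌈η * n⌉₊ * U.card ≤ (n + k * A.card) * U.card +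
        k * n * (((2 * a * (k - 1) : ℕ) : ℝ) + k) := by exact_mod_cast hCU
    have h2 : (k : ℝ) * (η * n) * U.card ≤ k * ⌈η * n⌉₊ * U.card := by
      gcongr; exact Nat.le_ceil _
    have h3 : ((n : ℝ) + k * A.card) * U.card ≤ (n + k * (ε / 2 * n)) * U.card := by
      gcongr
      refine hAc.trans ?_
      gcongr
    have h4 : (k : ℝ) * n * (((2 * a * (k - 1) : ℕ) : ℝ) + k) ≤ k * n * (ε * ρ / 8 * n) := by
      gcongr
      linarith
    have h5 : (k : ℝ) * η = k * ε + 1 := by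
      rw [hεη]; field_simp; ring
    have h6 : (k * n * (ε / 2) : ℝ) * U.card ≤ (k * n * (ε / 2)) * (ρ / 4 * n) := by
      have e1 : (k * n * (ε / 2) : ℝ) * U.card =
          (k : ℝ) * (η * n) * U.card - (n + k * (ε / 2 * n)) * U.card := by
        linear_combination (-((n : ℝ) * U.card)) * h5
      have e2 : (k * n * (ε / 2) : ℝ) * (ρ / 4 * n) = k * n * (ε * ρ / 8 * n) := by ring
      rw [e1, e2]
      linarith only [h1, h2, h3, h4]
    exact le_of_mul_le_mul_left h6 (by positivity)
  have hUA : Disjoint U A := by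
    rw [Finset.disjoint_left]
    intro z hz hz'
    exact (Finset.mem_sdiff.1 hz).2 (Finset.mem_union_left _ hz')
  have hUC : Disjoint U C := by
    rw [Finset.disjoint_left]
    intro z hz hz'
    exact (Finset.mem_sdiff.1 hz).2 (Finset.mem_union_right _ hz')
  have hcard : U.card + (A.card + C.card) = n := by
    have h1 := Finset.card_sdiff_add_card_eq_card (Finset.subset_univ (A ∪ C))
    rw [Finset.card_union_of_disjoint hCA.symm] at h1
    simpa using h1
  have hkU : k ∣ U.card := by
    have h1 := til_dvd (fam_til F hF)
    have h2 := til_dvd hC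
    rw [← hcard] at hkn
    exact (Nat.dvd_add_left (dvd_add h1 h2)).1 hkn
  obtain ⟨j, hj⟩ := hkU
  have habs := absorb hk hole ha j U F hF hj hUA (by
    intro u v
    rw [← hj]
    have h1 := hhits u v
    have : (U.card : ℝ) + (((2 * a * (k - 1) : ℕ) : ℝ) + 1) ≤ (hits G F u v).card := by
      linarith
    exact_mod_cast this)
  have hfin := til_union habs hC (by
    rw [Finset.disjoint_union_left]
    exact ⟨hCA.symm, hUC⟩)
  convert hfin using 1
  ext z
  simp only [Finset.mem_univ, Finset.mem_union, hU, Finset.mem_sdiff, true_and, true_iff, ← hA]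
  tauto

lemma hole_of {n : ℕ} {G : SimpleGraph (Fin n)} {x : ℝ} (h : HoleBound G x) :
    Hole G (⌊x⌋₊ + 1) := by
  intro A B hAB hA hB
  by_contra hcon
  push Not at hcon
  obtain ⟨A', hA', hA'c⟩ := Finset.exists_subset_card_eq hA
  obtain ⟨B', hB', hB'c⟩ := Finset.exists_subset_card_eq hB
  have h1 := h _ A' B' (Finset.disjoint_of_subset_left hA' (Finset.disjoint_of_subset_right hB' hAB))
    hA'c hB'c (fun u hu v hv => hcon u (hA' hu) v (hB' hv))
  have h2 := Nat.lt_floor_add_one x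
  push_cast at h1
  linarith

end RTT


open RTT in
/-- For every `k ≥ 4` and constant `1/k < η ≤ 1` there exists `α > 0` such that
for all sufficiently large `n` divisible by `k`, every `n`-vertex graph `G` with
`δ(G) ≥ ηn` and `α*(G) ≤ αn` contains a perfect `C_k`-tiling. -/
theorem perfect_cycle_tiling_bipartite_holes :
    ∀ k : ℕ, 4 ≤ k → ∀ η : ℝ, 1 / (k : ℝ) < η → η ≤ 1 →
    ∃ α : ℝ, 0 < α ∧ ∃ N : ℕ, ∀ n : ℕ, N ≤ n → k ∣ n →
      ∀ G : SimpleGraph (Fin n),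
        MinDegGE G (η * n) → HoleBound G (α * n) →
        PerfTilingOn (SimpleGraph.cycleGraph k) G Finset.univ := by
  intro k hk η hη hη1
  have hk' : (4 : ℝ) ≤ k := by exact_mod_cast hk
  have hk0 : (0 : ℝ) < k := by linarith
  have hη0 : 0 < η := lt_trans (by positivity) hη
  obtain ⟨ε, hε⟩ : ∃ ε, ε = η - 1 / (k : ℝ) := ⟨_, rfl⟩
  obtain ⟨θ, hθ⟩ : ∃ θ, θ = η ^ 5 / 4 := ⟨_, rfl⟩
  obtain ⟨μ, hμ⟩ : ∃ μ, μ = ε * η ^ 5 / 24 := ⟨_, rfl⟩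
  obtain ⟨ρ, hρ⟩ : ∃ ρ, ρ = θ * μ / (4 * (k : ℝ) ^ 2) := ⟨_, rfl⟩
  obtain ⟨α, hα⟩ : ∃ α, α = ε * ρ / (32 * (k : ℝ)) := ⟨_, rfl⟩
  have hε0 : 0 < ε := by rw [hε]; linarith
  have hθ0 : 0 < θ := by rw [hθ]; positivity
  have hμ0 : 0 < μ := by rw [hμ]; positivity
  have hρ0 : 0 < ρ := by rw [hρ]; positivity
  have hα0 : 0 < α := by rw [hα]; positivity
  have hlog : ∀ᶠ n : ℕ in Filter.atTop, 2 * Real.log (n : ℝ) ≤ ρ / 4 * n := by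
    have h1 := Real.isLittleO_log_id_atTop.def (show 0 < ρ / 8 by positivity)
    have h2 := tendsto_natCast_atTop_atTop (R := ℝ) |>.eventually h1
    filter_upwards [h2] with n hn
    have h3 : Real.log (n : ℝ) ≤ ρ / 8 * n := by
      refine (le_abs_self _).trans ?_
      simpa using hn
    linarith
  obtain ⟨N, hN⟩ := Filter.eventually_atTop.1 hlog
  refine ⟨α, hα0, max N (⌈3 * (k : ℝ) / (ε * ρ / 16)⌉₊ + 1), ?_⟩
  intro n hn hkn G hdeg hhole
  have hn1 : N ≤ n := (le_max_left _ _).trans hn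
  have hn2 : ⌈3 * (k : ℝ) / (ε * ρ / 16)⌉₊ + 1 ≤ n := (le_max_right _ _).trans hn
  have hc : 0 < ε * ρ / 16 := by positivity
  have E1 : 3 * (k : ℝ) ≤ ε * ρ / 16 * n := by
    have h1 : 3 * (k : ℝ) / (ε * ρ / 16) ≤ n :=
      (Nat.le_ceil _).trans (Nat.cast_le.2 (by omega))
    rw [div_le_iff₀ hc] at h1
    linarith
  refine core hk hkn (hole_of hhole) (by omega) hη0 hη1 hε0 hε hθ hμ hρ hα ?_ ?_
    (by omega) E1 (hN n hn1)
  · push_cast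
    have := Nat.floor_le (show 0 ≤ α * n by positivity)
    linarith
  · intro v
    have h1 := hdeg v
    have h2 : (G.neighborSet v).ncard = (nb G v).card := by
      rw [← Set.ncard_coe_finset]
      congr 1
      ext z
      simp [mem_nb]
    rwa [h2] at h1
end

section
/- For all integers k ≥ 3 and 1 ≤ r ≤ k−1, every constant 0 < η < 1 − r/k and every α > 0, the following holds for all sufficiently large n ∈ ℕ, where μ := 1 − kη/(k−r) > 0. There exists an n-vertex graph G with minimum degree δ(G) ≥ ηn and α_r(G) ≤ αn such that every K_k-tiling in G covers at most (1−μ)n vertices. -/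
open Finset

namespace RTTaux

def HG (p r : ℕ) : SimpleGraph ((ZMod p × ZMod p × ZMod p) × (ZMod p → Fin r)) where
  Adj a b := a.1.1 ≠ b.1.1 ∧ ∃ t : ZMod p, b.1.2.1 - a.1.2.1 = t * (b.1.1 - a.1.1) ∧
    b.1.2.2 - a.1.2.2 = t ^ 2 * (b.1.1 - a.1.1) ∧ a.2 t ≠ b.2 t
  symm := ⟨by
    rintro a b ⟨h, t, h1, h2, h3⟩
    exact ⟨h.symm, t, by linear_combination -h1, by linear_combination -h2, h3.symm⟩⟩
  loopless := ⟨by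
    rintro a ⟨h, _⟩
    exact h rfl⟩

lemma tri {F : Type*} [Field F] {c d s t u : F} (hc : c ≠ 0) (hd : d ≠ 0) (hcd : c + d ≠ 0)
    (h1 : c * s + d * t = (c + d) * u) (h2 : c * s ^ 2 + d * t ^ 2 = (c + d) * u ^ 2) :
    s = t ∧ u = s := by
  have h : c * d * (s - t) ^ 2 = 0 := by
    linear_combination (c + d) * h2 - (c * s + d * t + (c+d) * u) * h1
  have hst : s = t := by
    have := (mul_eq_zero.1 h).resolve_left (mul_ne_zero hc hd)
    exact sub_eq_zero.1 (pow_eq_zero_iff (two_ne_zero)|>.1 this)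
  refine ⟨hst, ?_⟩
  subst hst
  have : (c + d) * (u - s) = 0 := by linear_combination -h1
  exact sub_eq_zero.1 ((mul_eq_zero.1 this).resolve_left hcd)

lemma HG_cliqueFree (p r : ℕ) [Fact p.Prime] (hr : 2 ≤ r) : (HG p r).CliqueFree (r + 1) := by
  intro T hT
  have hcl := hT.isClique
  have hcard := hT.card_eq
  obtain ⟨a, ha, b, hb, hab⟩ := Finset.one_lt_card.1 (by omega : 1 < T.card)
  obtain ⟨hab1, t, h1, h2, h3⟩ := hcl ha hb hab
  have key : ∀ (a b c : (ZMod p × ZMod p × ZMod p) × (ZMod p → Fin r)) (t : ZMod p),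
      a.1.1 ≠ b.1.1 → b.1.2.1 - a.1.2.1 = t * (b.1.1 - a.1.1) →
      b.1.2.2 - a.1.2.2 = t ^ 2 * (b.1.1 - a.1.1) → (HG p r).Adj b c → (HG p r).Adj a c → 
      (c.1.2.1 - a.1.2.1 = t * (c.1.1 - a.1.1) ∧ 
      c.1.2.2 - a.1.2.2 = t ^ 2 * (c.1.1 - a.1.1) ∧ a.2 t ≠ c.2 t ∧ a.1.1 ≠ c.1.1) ∧ b.2 t ≠ c.2 t := by
    rintro a b c t hab h1 h2 ⟨hbc, u, h3, h4, h5⟩ ⟨hac, v, h6, h7, h8⟩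
    obtain ⟨rfl, rfl⟩ := tri (c := b.1.1 - a.1.1) (d := c.1.1 - b.1.1) (s := t) (t := u) (u := v)
      (sub_ne_zero.2 hab.symm) (sub_ne_zero.2 hbc.symm)
      (by rw [show b.1.1 - a.1.1 + (c.1.1 - b.1.1) = c.1.1 - a.1.1 by ring]; exact (sub_ne_zero.2 hac.symm)) 
      (by linear_combination -h1 - h3 + h6) (by linear_combination -h2 - h4 + h7)
    exact ⟨⟨h6, h7, h8, hac⟩, h5⟩
  have ka : ∀ c ∈ T, c ≠ a → (c.1.2.1 - a.1.2.1 = t * (c.1.1 - a.1.1) ∧ 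
      c.1.2.2 - a.1.2.2 = t ^ 2 * (c.1.1 - a.1.1) ∧ a.2 t ≠ c.2 t ∧ a.1.1 ≠ c.1.1) := by
    intro c hc hca
    by_cases hcb : c = b
    · subst hcb; exact ⟨h1, h2, h3, hab1⟩
    · exact (key a b c t hab1 h1 h2 (hcl hb hc (Ne.symm hcb)) (hcl ha hc (Ne.symm hca))).1
  have inj : Set.InjOn (fun c : (ZMod p × ZMod p × ZMod p) × (ZMod p → Fin r) => c.2 t) T := by
    intro x hx y hy hxy
    by_contra hne
    simp only at hxy
    by_cases hxa : x = a
    · subst hxa; exact (ka y hy (Ne.symm hne)).2.2.1 hxy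
    by_cases hya : y = a
    · subst hya; exact (ka x hx hne).2.2.1 hxy.symm
    obtain ⟨k1, k2, k3, k4⟩ := ka x hx hxa
    exact (key a x y t k4 k1 k2 (hcl hx hy hne) (hcl ha hy (Ne.symm hya))).2 hxy
  have := Finset.card_le_card_of_injOn _ (fun _ _ => Finset.mem_univ _) inj
  simp at this
  omega

lemma HG_nbr (p r : ℕ) [Fact p.Prime] (hr : 2 ≤ r) (a) : ∃ b, (HG p r).Adj a b := by
  have : Nontrivial (Fin r) := Fin.nontrivial_iff_two_le.2 hr
  obtain ⟨i, hi⟩ := exists_ne (a.2 0)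
  exact ⟨((a.1.1 + 1, a.1.2.1, a.1.2.2), fun _ => i), by simp, 0, by simp, by simp, hi.symm⟩

open Classical in
lemma HG_good (p r : ℕ) [Fact p.Prime] (hr : 2 ≤ r)
    (S : Finset ((ZMod p × ZMod p × ZMod p) × (ZMod p → Fin r)))
    (hS : ∀ T ⊆ S, ¬ (HG p r).IsNClique r T) (t : ZMod p) :
    (univ.filter (fun x : ZMod p × ZMod p × ZMod p => ∀ i : Fin r, ∃ σ, (x, σ) ∈ S ∧ σ t = i)).card
      ≤ (r - 1) * p ^ 2 := by
  by_contra hcon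
  push Not at hcon
  set Gd := univ.filter (fun x : ZMod p × ZMod p × ZMod p => ∀ i : Fin r, ∃ σ, (x, σ) ∈ S ∧ σ t = i)
    with hGd
  let f : ZMod p × ZMod p × ZMod p → ZMod p × ZMod p :=
    fun x => (x.2.1 - t * x.1, x.2.2 - t ^ 2 * x.1)
  obtain ⟨y, -, hy⟩ := Finset.exists_lt_card_fiber_of_mul_lt_card_of_maps_to
    (s := Gd) (t := univ) (f := f) (n := r - 1) (fun _ _ => mem_univ _) (by
      rw [card_univ, Fintype.card_prod, ZMod.card, mul_comm, ← pow_two]; exact hcon)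
  obtain ⟨Q, hQ, hQc⟩ := Finset.exists_subset_card_eq
    (show r ≤ (Gd.filter (fun x => f x = y)).card by omega)
  have hQm : ∀ x ∈ Q, (∀ i : Fin r, ∃ σ, (x, σ) ∈ S ∧ σ t = i) ∧ f x = y := by
    intro x hx
    have := hQ hx
    simp only [mem_filter, hGd, mem_univ, true_and] at this
    exact this
  let e := (Q.equivFinOfCardEq hQc).symm
  choose σ hσ hσt using fun i : Fin r => (hQm (e i) (e i).2).1 i
  have hinj : Function.Injective (fun i : Fin r => ((e i : ZMod p × ZMod p × ZMod p), σ i)) := by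
    intro i j hij
    simp only [Prod.mk.injEq] at hij
    rw [← hσt i, ← hσt j, hij.2]
  refine hS (univ.image (fun i : Fin r => ((e i : ZMod p × ZMod p × ZMod p), σ i))) ?_ ⟨?_, ?_⟩
  · intro z hz
    obtain ⟨i, -, rfl⟩ := mem_image.1 hz
    exact hσ i
  · intro a ha b hb hab
    simp only [coe_image, coe_univ, Set.image_univ, Set.mem_range] at ha hb
    obtain ⟨i, rfl⟩ := ha
    obtain ⟨j, rfl⟩ := hb
    have hij : i ≠ j := by rintro rfl; exact hab rfl
    have h1 := (hQm (e i) (e i).2).2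
    have h2 := (hQm (e j) (e j).2).2
    have h3 := h1.trans h2.symm
    simp only [f, Prod.mk.injEq] at h3
    refine ⟨?_, t, ?_, ?_, ?_⟩
    · intro h
      simp only at h
      apply hij
      apply e.injective
      apply Subtype.ext
      have h31 := h3.1
      have h32 := h3.2
      rw [h] at h31 h32
      exact Prod.ext h (Prod.ext (sub_left_injective h31) (sub_left_injective h32))
    · linear_combination -h3.1
    · linear_combination -h3.2
    · simp only [hσt]; exact hij
  · rw [card_image_of_injective _ hinj]; simp

open Classical in
lemma HG_count (p r : ℕ) [Fact p.Prime] (hr : 2 ≤ r)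
    (S : Finset ((ZMod p × ZMod p × ZMod p) × (ZMod p → Fin r)))
    (hS : ∀ T ⊆ S, ¬ (HG p r).IsNClique r T) :
    (S.card : ℝ) ≤ (2 * (r - 1) / p + ((r - 1) / r : ℝ) ^ (p / 2)) * (p ^ 3 * r ^ p) := by
  have hp : 0 < p := (Fact.out : p.Prime).pos
  have hpR : (0 : ℝ) < p := by exact_mod_cast hp
  have hrR : (2 : ℝ) ≤ r := by exact_mod_cast hr
  have hr1 : ((r - 1 : ℕ) : ℝ) = r - 1 := by push_cast [show 1 ≤ r by omega]; ring
  let P : (ZMod p × ZMod p × ZMod p) → ZMod p → Prop := 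
    fun x t => ∀ i : Fin r, ∃ σ, (x, σ) ∈ S ∧ σ t = i
  let g : (ZMod p × ZMod p × ZMod p) → ℕ := fun x => (univ.filter (fun t => P x t)).card
  have hgp : ∀ x, g x ≤ p := fun x => by
    have := card_filter_le (univ : Finset (ZMod p)) (fun t => P x t)
    simpa [g, ZMod.card] using this
  have hg : ∑ x, g x ≤ p * ((r - 1) * p ^ 2) := by
    have : ∑ x, g x = ∑ t : ZMod p, (univ.filter (fun x => P x t)).card := by
      simp only [g, card_filter]
      exact sum_comm
    rw [this]
    calc _ ≤ ∑ t : ZMod p, (r - 1) * p ^ 2 := sum_le_sum fun t _ => HG_good p r hr S hS t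
      _ = _ := by simp [ZMod.card]
  let X := univ.filter (fun x => p < 2 * g x)
  have hX : X.card * p ≤ (2 * (r - 1) * p ^ 2) * p := by
    calc X.card * p = ∑ x ∈ X, p := by simp
      _ ≤ ∑ x ∈ X, 2 * g x := sum_le_sum fun x hx => (mem_filter.1 hx).2.le
      _ ≤ ∑ x, 2 * g x := sum_le_univ_sum_of_nonneg (fun _ => Nat.zero_le _)
      _ = 2 * ∑ x, g x := by rw [mul_sum]
      _ ≤ 2 * (p * ((r - 1) * p ^ 2)) := by gcongr
      _ = _ := by ring
  have hX' : X.card ≤ 2 * (r - 1) * p ^ 2 := Nat.le_of_mul_le_mul_right hX hp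
  let Sx : (ZMod p × ZMod p × ZMod p) → Finset (ZMod p → Fin r) :=
    fun x => univ.filter (fun σ => (x, σ) ∈ S)
  have hcard : S.card = ∑ x, (Sx x).card := by
    rw [card_eq_sum_card_fiberwise (f := Prod.fst) (t := univ) (fun _ _ => mem_univ _)]
    refine sum_congr rfl fun x _ => ?_
    refine card_bij' (fun a _ => a.2) (fun σ _ => (x, σ)) ?_ ?_ ?_ ?_
    · rintro ⟨a, b⟩ h
      simp only [mem_filter] at h
      obtain ⟨h, rfl⟩ := h
      simpa [Sx] using h
    · intro σ h
      simpa [Sx] using h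
    · rintro ⟨a, b⟩ h
      simp only [mem_filter] at h
      simp [h.2]
    · simp
  have hSx : ∀ x, ((Sx x).card : ℝ) ≤ r ^ p * ((r - 1) / r : ℝ) ^ (p - g x) := by
    intro x
    have h1 : Sx x ⊆ Fintype.piFinset (fun t => (Sx x).image (fun σ => σ t)) := by
      intro σ hσ
      rw [Fintype.mem_piFinset]
      exact fun t => mem_image_of_mem _ hσ
    have h2 := card_le_card h1
    rw [Fintype.card_piFinset] at h2
    have h3 : ∏ t, ((Sx x).image (fun σ => σ t)).card ≤ ∏ t, (if P x t then r else r - 1) := by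
      refine prod_le_prod' fun t _ => ?_
      split_ifs with h
      · simpa using card_le_univ ((Sx x).image (fun σ => σ t))
      · simp only [P, not_forall] at h
        obtain ⟨i, hi⟩ := h
        have : (Sx x).image (fun σ => σ t) ⊆ univ.erase i := by
          intro j hj
          obtain ⟨σ, hσ, rfl⟩ := mem_image.1 hj
          refine mem_erase.2 ⟨fun h => hi ⟨σ, by simpa [Sx] using hσ, h⟩, mem_univ _⟩
        simpa using card_le_card this
    have h4 : ∏ t, (if P x t then r else r - 1) = r ^ (g x) * (r - 1) ^ (p - g x) := by
      rw [prod_ite, prod_const, prod_const]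
      congr 2
      have := card_filter_add_card_filter_not (s := (univ : Finset (ZMod p))) (fun t => P x t)
      rw [card_univ, ZMod.card] at this
      simp only [g]
      omega
    have h5 : (Sx x).card ≤ r ^ (g x) * (r - 1) ^ (p - g x) := (h2.trans h3).trans_eq h4
    calc ((Sx x).card : ℝ) ≤ ((r ^ (g x) * (r - 1) ^ (p - g x) : ℕ) : ℝ) := by exact_mod_cast h5
      _ = (r : ℝ) ^ (g x) * (r - 1) ^ (p - g x) := by push_cast [hr1]; rfl
      _ = r ^ (g x + (p - g x)) * ((r - 1) / r : ℝ) ^ (p - g x) := by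
        rw [div_pow, pow_add]; field_simp
      _ = _ := by rw [Nat.add_sub_cancel' (hgp x)]
  have hρ0 : (0 : ℝ) ≤ (r - 1) / r := by apply div_nonneg <;> linarith
  have hρ1 : ((r - 1) / r : ℝ) ≤ 1 := by rw [div_le_one] <;> linarith
  have hSx2 : ∀ x, ((Sx x).card : ℝ) ≤ (if x ∈ X then (r : ℝ) ^ p else 0) + r ^ p * ((r - 1) / r : ℝ) ^ (p / 2) := by
    intro x
    refine (hSx x).trans ?_
    split_ifs with h
    · have : (r:ℝ) ^ p * ((r - 1) / r : ℝ) ^ (p - g x) ≤ r ^ p * 1 := by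
        gcongr; exact pow_le_one₀ hρ0 hρ1
      have : 0 ≤ (r:ℝ) ^ p * ((r - 1) / r : ℝ) ^ (p / 2) := by positivity
      linarith
    · rw [zero_add]
      have : ¬ p < 2 * g x := fun h' => h (mem_filter.2 ⟨mem_univ _, h'⟩)
      gcongr ?_ * ?_
      exact pow_le_pow_of_le_one hρ0 hρ1 (by omega)
  calc (S.card : ℝ) = ∑ x, ((Sx x).card : ℝ) := by rw [hcard]; push_cast; rfl
    _ ≤ ∑ x, ((if x ∈ X then (r : ℝ) ^ p else 0) + r ^ p * ((r - 1) / r : ℝ) ^ (p / 2)) := 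
        sum_le_sum fun x _ => hSx2 x
    _ = X.card * (r : ℝ) ^ p + p ^ 3 * (r ^ p * ((r - 1) / r : ℝ) ^ (p / 2)) := by
        rw [sum_add_distrib, ← sum_filter, sum_const, sum_const, card_univ]
        simp only [Fintype.card_prod, ZMod.card, filter_univ_mem, nsmul_eq_mul]
        push_cast; ring
    _ ≤ ((2 * (r - 1) * p ^ 2 : ℕ) : ℝ) * (r : ℝ) ^ p + p ^ 3 * (r ^ p * ((r - 1) / r : ℝ) ^ (p / 2)) := by
        gcongr
    _ = _ := by push_cast [hr1]; field_simp

lemma exists_H (r : ℕ) (hr : 2 ≤ r) (ε : ℝ) (hε : 0 < ε) :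
    ∃ (q : ℕ) (H : SimpleGraph (Fin q)), 0 < q ∧ H.CliqueFree (r + 1) ∧ (∀ v, ∃ w, H.Adj v w) ∧
      ∀ S : Finset (Fin q), (∀ T ⊆ S, ¬ H.IsNClique r T) → (S.card : ℝ) ≤ ε * q := by
  have hrR : (2 : ℝ) ≤ r := by exact_mod_cast hr
  have hρ0 : (0 : ℝ) ≤ (r - 1) / r := by apply div_nonneg <;> linarith
  have hρ1 : ((r - 1) / r : ℝ) < 1 := by rw [div_lt_one] <;> linarith
  obtain ⟨M, hM⟩ := exists_pow_lt_of_lt_one (half_pos hε) hρ1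
  obtain ⟨N, hN⟩ := exists_nat_gt (2 * (r - 1) / (ε / 2) : ℝ)
  obtain ⟨p, hpN, hp⟩ := Nat.exists_infinite_primes (N + 2 * M)
  have : Fact p.Prime := ⟨hp⟩
  have hpR : (0 : ℝ) < p := by exact_mod_cast hp.pos
  have hcard : Fintype.card ((ZMod p × ZMod p × ZMod p) × (ZMod p → Fin r)) = p ^ 3 * r ^ p := by
    rw [Fintype.card_prod, Fintype.card_prod, Fintype.card_prod, Fintype.card_fun, ZMod.card,
      Fintype.card_fin]
    ring
  have : NeZero r := ⟨by omega⟩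
  let e := Fintype.equivFinOfCardEq hcard
  refine ⟨p ^ 3 * r ^ p, (HG p r).map e.toEmbedding, ?_, ?_, ?_, ?_⟩
  · have := hp.pos
    positivity
  · exact (SimpleGraph.cliqueFree_map_iff).2 (HG_cliqueFree p r hr)
  · intro v
    obtain ⟨b, hb⟩ := HG_nbr p r hr (e.symm v)
    refine ⟨e b, ?_⟩
    have := (SimpleGraph.map_adj_apply (G := HG p r) (f := e.toEmbedding) (a := e.symm v) (b := b)).2 hb
    simpa using this
  · intro S hS
    have h := HG_count p r hr (S.map e.symm.toEmbedding) (by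
      intro T hT hcl
      refine hS (T.map e.toEmbedding) ?_ (hcl.map)
      intro x hx
      obtain ⟨y, hy, rfl⟩ := mem_map.1 hx
      have := hT hy
      simpa [mem_map_equiv] using this)
    rw [card_map] at h
    refine h.trans ?_
    push_cast
    gcongr
    have h1 : (2 * (r - 1) / p : ℝ) ≤ ε / 2 := by
      rw [div_le_iff₀ hpR]
      rw [div_lt_iff₀ (by positivity)] at hN
      have : (N : ℝ) ≤ p := by exact_mod_cast (by omega : N ≤ p)
      nlinarith
    have h2 : ((r - 1) / r : ℝ) ^ (p / 2) ≤ ε / 2 :=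
      (pow_le_pow_of_le_one hρ0 hρ1.le (by omega)).trans hM.le
    linarith

end RTTaux
namespace RTTaux

open RTT

/-- copies of `K_k` are cliques -/
lemma spans_clique {k n : ℕ} {G : SimpleGraph (Fin n)} {S : Finset (Fin n)}
    (h : SpansCopy (⊤ : SimpleGraph (Fin k)) G S) : G.IsNClique k S := by
  obtain ⟨f, hf, hadj, rfl⟩ := h
  refine ⟨?_, by rw [card_image_of_injective _ hf]; simp⟩
  intro a ha b hb hab
  simp only [coe_image, coe_univ, Set.image_univ, Set.mem_range] at ha hb
  obtain ⟨i, rfl⟩ := ha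
  obtain ⟨j, rfl⟩ := hb
  exact hadj i j (by rintro rfl; exact hab rfl)

/-- counting a tiling by its intersection with a set -/
lemma tiling_count {k n d : ℕ} {G : SimpleGraph (Fin n)} {T : Finset (Finset (Fin n))}
    (hT : IsTiling (⊤ : SimpleGraph (Fin k)) G T) (A : Finset (Fin n))
    (hA : ∀ S : Finset (Fin n), G.IsNClique k S → d ≤ (S ∩ A).card) :
    T.card * d ≤ A.card ∧ (T.biUnion id).card ≤ k * T.card := by
  constructor
  · have hd : (T : Set (Finset (Fin n))).PairwiseDisjoint (fun S => S ∩ A) := by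
      intro S hS S' hS' hne
      exact (hT.2 S hS S' hS' hne).mono inter_subset_left inter_subset_left
    calc T.card * d = ∑ S ∈ T, d := by simp
      _ ≤ ∑ S ∈ T, (S ∩ A).card := sum_le_sum fun S hS => hA S (spans_clique (hT.1 S hS))
      _ = (T.biUnion (fun S => S ∩ A)).card := (card_biUnion hd).symm
      _ ≤ A.card := card_le_card (biUnion_subset.2 fun S _ => inter_subset_right)
  · calc (T.biUnion id).card ≤ ∑ S ∈ T, (id S).card := card_biUnion_le
      _ = ∑ S ∈ T, k := sum_congr rfl fun S hS => (spans_clique (hT.1 S hS)).card_eq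
      _ = _ := by simp [mul_comm]

def MG (n s : ℕ) : SimpleGraph (Fin n) where
  Adj u v := (u : ℕ) / s ≠ (v : ℕ) / s
  symm := ⟨fun _ _ h => Ne.symm h⟩
  loopless := ⟨fun _ h => h rfl⟩

lemma MG_deg (n s : ℕ) (hs : 0 < s) (v : Fin n) : n - s ≤ ((MG n s).neighborSet v).ncard := by
  classical
  have h1 : (MG n s).neighborSet v = ((univ.filter (fun u : Fin n => (v : ℕ) / s ≠ (u : ℕ) / s) : Finset (Fin n)) : Set (Fin n)) := by
    ext u; simp [MG, SimpleGraph.mem_neighborSet]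
  rw [h1, Set.ncard_coe_finset]
  have h2 := card_filter_add_card_filter_not (s := (univ : Finset (Fin n)))
    (fun u : Fin n => (v : ℕ) / s ≠ (u : ℕ) / s)
  have h3 : (univ.filter (fun u : Fin n => ¬ (v : ℕ) / s ≠ (u : ℕ) / s)).card ≤ (range s).card := by
    refine card_le_card_of_injOn (fun u : Fin n => (u : ℕ) % s) ?_ ?_
    · intro u _
      simpa using Nat.mod_lt _ hs
    · intro a ha b hb hab
      simp only [coe_filter, mem_univ, true_and, not_not, Set.mem_setOf_eq, ne_eq] at ha hb
      simp only at hab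
      apply Fin.ext
      rw [← Nat.div_add_mod (a : ℕ) s, ← Nat.div_add_mod (b : ℕ) s, hab, ← ha, hb]
  simp only [card_univ, Fintype.card_fin, card_range] at h2 h3
  omega

lemma MG_clique (n s k : ℕ) (hs : 0 < s) (hk : 1 ≤ k) (S : Finset (Fin n))
    (hS : (MG n s).IsNClique k S) :
    1 ≤ (S ∩ univ.filter (fun u : Fin n => (k - 1) * s ≤ u)).card := by
  by_contra hcon
  have h0 : S ∩ univ.filter (fun u : Fin n => (k - 1) * s ≤ u) = ∅ := by
    rw [← card_eq_zero]; omega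
  have : S.card ≤ (range (k - 1)).card := by
    refine card_le_card_of_injOn (fun u : Fin n => (u : ℕ) / s) ?_ ?_
    · intro u hu
      have : u ∉ S ∩ univ.filter (fun u : Fin n => (k - 1) * s ≤ u) := by simp [h0]
      simp only [mem_inter, mem_filter, mem_univ, true_and, not_and, not_le] at this
      simpa using (Nat.div_lt_iff_lt_mul hs).2 (this hu)
    · intro a ha b hb hab
      by_contra hne
      exact hS.isClique ha hb hne hab
  rw [hS.card_eq, card_range] at this
  omega

lemma card_ge (n c : ℕ) : (univ.filter (fun u : Fin n => c ≤ (u : ℕ))).card ≤ n - c := by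
  have : (univ.filter (fun u : Fin n => c ≤ (u : ℕ))).card ≤ (Finset.Ico c n).card := by
    refine card_le_card_of_injOn (fun u : Fin n => (u : ℕ)) ?_ ?_
    · intro u hu
      simp at hu ⊢
      exact hu
    · exact Fin.val_injective.injOn
  simpa using this

lemma case_one (k : ℕ) (hk : 3 ≤ k) (η α : ℝ) (hη0 : 0 < η) (hη : η < 1 - 1 / (k : ℝ))
    (hα : 0 < α) :
    ∃ N : ℕ, ∀ n : ℕ, N ≤ n →
      ∃ G : SimpleGraph (Fin n),
        MinDegGE G (η * n) ∧ IndepBound G 1 (α * n) ∧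
        ∀ T : Finset (Finset (Fin n)), IsTiling (⊤ : SimpleGraph (Fin k)) G T →
          ((T.biUnion id).card : ℝ) ≤ (k : ℝ) * η / ((k : ℝ) - 1) * n := by
  have hkR : (3 : ℝ) ≤ k := by exact_mod_cast hk
  have hηk : η * k < k - 1 := by
    have := mul_lt_mul_of_pos_right hη (by linarith : (0:ℝ) < k)
    rwa [sub_mul, one_div, inv_mul_cancel₀ (by linarith), one_mul] at this
  have hη1 : η < 1 := by nlinarith
  set g : ℝ := (k - 2) - η * k * (k - 2) / (k - 1) with hg
  have hg0 : 0 < g := by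
    rw [hg, sub_pos, div_lt_iff₀ (by linarith)]
    nlinarith
  obtain ⟨N1, hN1⟩ := exists_nat_gt (1 / (1 - η))
  obtain ⟨N2, hN2⟩ := exists_nat_gt (((k : ℝ) - 1) / g)
  refine ⟨N1 + N2, fun n hn => ?_⟩
  have hn1 : 1 < n * (1 - η) := by
    rw [div_lt_iff₀ (by linarith)] at hN1
    have : (N1 : ℝ) ≤ n := by exact_mod_cast (by omega : N1 ≤ n)
    nlinarith
  have hn2 : (k : ℝ) - 1 < n * g := by
    rw [div_lt_iff₀ hg0] at hN2
    have : (N2 : ℝ) ≤ n := by exact_mod_cast (by omega : N2 ≤ n)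
    nlinarith
  set m := ⌈η * n⌉₊ with hm
  have hm1 : η * n ≤ m := Nat.le_ceil _
  have hm2 : (m : ℝ) < η * n + 1 := Nat.ceil_lt_add_one (by positivity)
  have hmn : m < n := by
    have : (m : ℝ) < n := by linarith
    exact_mod_cast this
  refine ⟨MG n (n - m), ?_, ?_, ?_⟩
  · intro v
    refine hm1.trans ?_
    have := MG_deg n (n - m) (by omega) v
    exact_mod_cast (by omega)
  · intro S hS
    have : S = ∅ := by
      by_contra h
      obtain ⟨x, hx⟩ := Finset.nonempty_iff_ne_empty.2 h
      exact hS {x} (by simpa using hx) (by simp [SimpleGraph.isNClique_iff])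
    subst this
    simp; positivity
  · intro T hT
    obtain ⟨h1, h2⟩ := tiling_count (d := 1) hT _ (MG_clique n (n - m) k (by omega) (by omega))
    have h3 := h1.trans (card_ge n ((k - 1) * (n - m)))
    rw [mul_one] at h3
    have h2' : ((T.biUnion id).card : ℝ) ≤ k * T.card := by exact_mod_cast h2
    refine h2'.trans ?_
    rw [mul_div_assoc, mul_assoc]
    gcongr
    have hk1 : (0:ℝ) < k - 1 := by linarith
    rcases le_total n ((k - 1) * (n - m)) with h | h
    · have : T.card = 0 := by omega
      rw [this]; simp; positivity
    · have h4 : T.card + (k - 1) * (n - m) ≤ n := by omega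
      have h5 : (T.card : ℝ) + (k - 1) * (n - m) ≤ n := by
        have : ((T.card + (k - 1) * (n - m) : ℕ) : ℝ) ≤ n := by exact_mod_cast h4
        push_cast [hmn.le, (by omega : 1 ≤ k)] at this
        exact this
      have h6 : η / (k - 1) * n = (k - 1) * η * n + n * g - n * (k - 2) := by
        rw [hg]; field_simp; ring
      rw [h6]
      nlinarith

def BG (n m q : ℕ) (hq : 0 < q) (H : SimpleGraph (Fin q)) : SimpleGraph (Fin n) where
  Adj u v := u ≠ v ∧ ((u : ℕ) < m ∨ (v : ℕ) < m ∨
    H.Adj ⟨(u - m) % q, Nat.mod_lt _ hq⟩ ⟨(v - m) % q, Nat.mod_lt _ hq⟩)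
  symm := ⟨by
    rintro u v ⟨h, h'⟩
    refine ⟨h.symm, ?_⟩
    rcases h' with h | h | h
    · exact Or.inr (Or.inl h)
    · exact Or.inl h
    · exact Or.inr (Or.inr h.symm)⟩
  loopless := ⟨fun _ h => h.1 rfl⟩

lemma BG_deg (n m q : ℕ) (hq : 0 < q) (H : SimpleGraph (Fin q)) (hH : ∀ v, ∃ w, H.Adj v w)
    (hm : m + q ≤ n) (v : Fin n) : m + 1 ≤ ((BG n m q hq H).neighborSet v).ncard := by
  classical
  by_cases hv : (v : ℕ) < m
  · have : ((univ.erase v : Finset (Fin n)) : Set (Fin n)) ⊆ (BG n m q hq H).neighborSet v := by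
      intro u hu
      have hu : u ≠ v := by simpa using hu
      exact ⟨hu.symm, Or.inl hv⟩
    have h := Set.ncard_le_ncard this (Set.toFinite _)
    rw [Set.ncard_coe_finset, card_erase_of_mem (mem_univ _), card_univ, Fintype.card_fin] at h
    obtain ⟨w, hw⟩ := hH ⟨0, hq⟩
    have hq2 : 2 ≤ q := by
      by_contra h
      have : w = ⟨0, hq⟩ := Fin.ext (by have := w.2; simp; omega)
      subst this
      exact H.loopless.irrefl _ hw
    omega
  · obtain ⟨w, hw⟩ := hH ⟨(v - m) % q, Nat.mod_lt _ hq⟩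
    let u : Fin n := ⟨m + w, by omega⟩
    have hsub : ((insert u (univ.filter (fun x : Fin n => (x : ℕ) < m)) : Finset (Fin n)) : Set (Fin n)) ⊆
        (BG n m q hq H).neighborSet v := by
      intro x hx
      simp only [coe_insert, coe_filter, mem_univ, true_and, Set.mem_insert_iff,
        Set.mem_setOf_eq] at hx
      have hw' : H.Adj ⟨(v - m) % q, Nat.mod_lt _ hq⟩ ⟨(u - m) % q, Nat.mod_lt _ hq⟩ := by
        convert hw using 1
        apply Fin.ext
        simp [u, Nat.mod_eq_of_lt w.2]
      rcases hx with rfl | hx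
      · refine ⟨?_, Or.inr (Or.inr hw')⟩
        intro h
        rw [← h] at hw'
        exact H.loopless.irrefl _ hw'
      · exact ⟨by rintro rfl; exact hv hx, Or.inr (Or.inl hx)⟩
    have h := Set.ncard_le_ncard hsub (Set.toFinite _)
    rw [Set.ncard_coe_finset, card_insert_of_notMem (by simp [u])] at h
    have h2 := card_filter_add_card_filter_not (s := (univ : Finset (Fin n)))
      (fun u : Fin n => (u : ℕ) < m)
    have h3 := card_ge n m
    simp only [not_lt, card_univ, Fintype.card_fin] at h2
    omega

lemma BG_clique (n m q : ℕ) (hq : 0 < q) (H : SimpleGraph (Fin q)) (r k : ℕ)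
    (hH : H.CliqueFree (r + 1)) (S : Finset (Fin n)) (hS : (BG n m q hq H).IsNClique k S) :
    k - r ≤ (S ∩ univ.filter (fun x : Fin n => (x : ℕ) < m)).card := by
  classical
  set B := S.filter (fun x : Fin n => ¬ (x : ℕ) < m) with hB
  have h1 : (S ∩ univ.filter (fun x : Fin n => (x : ℕ) < m)).card + B.card = k := by
    rw [← hS.card_eq, ← card_filter_add_card_filter_not (s := S) (fun x : Fin n => (x : ℕ) < m)]
    congr 2
    ext x; simp
  have h2 : B.card ≤ r := by
    by_contra hcon
    let φ : Fin n → Fin q := fun u => ⟨(u - m) % q, Nat.mod_lt _ hq⟩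
    have hadj : ∀ x ∈ B, ∀ y ∈ B, x ≠ y → H.Adj (φ x) (φ y) := by
      intro x hx y hy hxy
      rw [hB, mem_filter] at hx hy
      rcases (hS.isClique hx.1 hy.1 hxy).2 with h | h | h
      · exact absurd h hx.2
      · exact absurd h hy.2
      · exact h
    have hcl : H.IsNClique B.card (B.image φ) := by
      refine ⟨?_, card_image_of_injOn ?_⟩
      · intro a ha b hb hab
        simp only [coe_image, Set.mem_image, mem_coe] at ha hb
        obtain ⟨x, hx, rfl⟩ := ha
        obtain ⟨y, hy, rfl⟩ := hb
        exact hadj x hx y hy (by rintro rfl; exact hab rfl)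
      · intro x hx y hy hxy
        by_contra hne
        exact (hadj x hx y hy hne).ne hxy
    exact (hH.mono (by omega : r + 1 ≤ B.card)) _ hcl
  omega

lemma BG_indep (n m q : ℕ) (hq : 0 < q) (H : SimpleGraph (Fin q)) (r : ℕ) (ε : ℝ) (hε : 0 < ε)
    (hH : ∀ S : Finset (Fin q), (∀ T ⊆ S, ¬ H.IsNClique r T) → (S.card : ℝ) ≤ ε * q)
    (S : Finset (Fin n)) (hS : ∀ T ⊆ S, ¬ (BG n m q hq H).IsNClique r T) :
    (S.card : ℝ) ≤ r + (ε * n + ε * q) := by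
  classical
  rw [← card_filter_add_card_filter_not (s := S) (fun x : Fin n => (x : ℕ) < m)]
  push_cast
  gcongr
  · by_contra hcon
    push Not at hcon
    obtain ⟨Q, hQ, hQc⟩ := exists_subset_card_eq hcon.le
    refine hS Q (hQ.trans (filter_subset _ _)) ⟨?_, hQc⟩
    intro a ha b _ hab
    exact ⟨hab, Or.inl (mem_filter.1 (hQ ha)).2⟩
  · set B := S.filter (fun x : Fin n => ¬ (x : ℕ) < m) with hB
    let φ : Fin n → Fin q := fun u => ⟨(u - m) % q, Nat.mod_lt _ hq⟩
    have h1 : ((B.image φ).card : ℝ) ≤ ε * q := by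
      refine hH _ fun T hT hcl => ?_
      obtain ⟨Q, hQ, hQT, hinj⟩ : ∃ Q ⊆ B, Q.image φ = T ∧ Set.InjOn φ Q := by
        rcases isEmpty_or_nonempty (Fin n) with hn | hn
        · refine ⟨∅, by simp, ?_, by simp⟩
          rw [eq_comm, image_empty, eq_empty_iff_forall_notMem]
          intro x hx
          obtain ⟨y, -, -⟩ := mem_image.1 (hT hx)
          exact hn.elim y
        choose! g hg hg' using fun x (hx : x ∈ T) => mem_image.1 (hT hx)
        refine ⟨T.image g, ?_, ?_, ?_⟩
        · intro x hx
          obtain ⟨y, hy, rfl⟩ := mem_image.1 hx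
          exact hg y hy
        · rw [image_image]
          ext x
          simp only [mem_image, Function.comp]
          constructor
          · rintro ⟨a, ha, rfl⟩
            rwa [hg' a ha]
          · exact fun hx => ⟨x, hx, hg' x hx⟩
        · intro x hx y hy hxy
          simp only [coe_image, Set.mem_image, mem_coe] at hx hy
          obtain ⟨a, ha, rfl⟩ := hx
          obtain ⟨b, hb, rfl⟩ := hy
          rw [hg' a ha, hg' b hb] at hxy
          rw [hxy]
      refine hS Q (hQ.trans (filter_subset _ _)) ⟨?_, ?_⟩
      · intro a ha b hb hab
        refine ⟨hab, Or.inr (Or.inr ?_)⟩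
        have hca : φ a ∈ T := hQT ▸ mem_image_of_mem _ ha
        have hcb : φ b ∈ T := hQT ▸ mem_image_of_mem _ hb
        exact hcl.isClique hca hcb (fun h => hab (hinj ha hb h))
      · rw [← card_image_of_injOn hinj, hQT, hcl.card_eq]
    have h2 : B.card ≤ (n / q + 1) * (B.image φ).card := by
      refine card_le_mul_card_image _ _ fun w _ => ?_
      rw [← card_range (n / q + 1)]
      refine card_le_card_of_injOn (fun u : Fin n => ((u : ℕ) - m) / q) ?_ ?_
      · intro u _
        have : ((u : ℕ) - m) / q ≤ n / q := Nat.div_le_div_right (by omega)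
        simp only [coe_range, Set.mem_Iio]
        omega
      · intro a ha b hb hab
        simp only [coe_filter, Set.mem_setOf_eq, hB, mem_filter, not_lt] at ha hb
        have h := congrArg Fin.val (ha.2.trans hb.2.symm)
        simp only [φ] at h hab
        have : (a : ℕ) - m = b - m := by
          rw [← Nat.div_add_mod ((a : ℕ) - m) q, ← Nat.div_add_mod ((b : ℕ) - m) q, hab, h]
        apply Fin.ext
        have := ha.1.2
        have := hb.1.2
        omega
    have hqR : (0 : ℝ) < q := by exact_mod_cast hq
    calc (B.card : ℝ) ≤ ((n / q : ℕ) + 1) * (B.image φ).card := by exact_mod_cast h2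
      _ ≤ ((n : ℝ) / q + 1) * (ε * q) := by
        gcongr
        exact Nat.cast_div_le
      _ = _ := by field_simp

lemma case_two (k r : ℕ) (hr : 2 ≤ r) (hrk : r < k) (η α : ℝ) (hη0 : 0 < η) (hη : η < 1)
    (hα : 0 < α) :
    ∃ N : ℕ, ∀ n : ℕ, N ≤ n →
      ∃ G : SimpleGraph (Fin n),
        MinDegGE G (η * n) ∧ IndepBound G r (α * n) ∧
        ∀ T : Finset (Finset (Fin n)), IsTiling (⊤ : SimpleGraph (Fin k)) G T →
          ((T.biUnion id).card : ℝ) ≤ (k : ℝ) * η / ((k : ℝ) - r) * n := by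
  obtain ⟨q, H, hq, hfree, hnbr, hind⟩ := exists_H r hr (α / 2) (by positivity)
  obtain ⟨N1, hN1⟩ := exists_nat_gt ((q : ℝ) / (1 - η))
  obtain ⟨N2, hN2⟩ := exists_nat_gt ((r + α / 2 * q) / (α / 2))
  refine ⟨N1 + N2, fun n hn => ?_⟩
  have hn1 : q < n * (1 - η) := by
    rw [div_lt_iff₀ (by linarith)] at hN1
    have : (N1 : ℝ) ≤ n := by exact_mod_cast (by omega : N1 ≤ n)
    nlinarith
  have hn2 : r + α / 2 * q < n * (α / 2) := by
    rw [div_lt_iff₀ (by positivity)] at hN2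
    have : (N2 : ℝ) ≤ n := by exact_mod_cast (by omega : N2 ≤ n)
    nlinarith
  set m := ⌊η * n⌋₊ with hm
  have hm1 : (m : ℝ) ≤ η * n := Nat.floor_le (by positivity)
  have hm2 : η * n < m + 1 := Nat.lt_floor_add_one _
  have hmn : m + q ≤ n := by
    have : (m : ℝ) + q ≤ n := by linarith
    exact_mod_cast this
  refine ⟨BG n m q hq H, ?_, ?_, ?_⟩
  · intro v
    refine hm2.le.trans ?_
    exact_mod_cast BG_deg n m q hq H hnbr hmn v
  · intro S hS
    have := BG_indep n m q hq H r (α / 2) (by positivity) hind S hS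
    linarith
  · intro T hT
    obtain ⟨h1, h2⟩ := tiling_count (d := k - r) hT _ (fun S => BG_clique n m q hq H r k hfree S)
    have hA : (univ.filter (fun x : Fin n => (x : ℕ) < m)).card ≤ m := by
      have : (univ.filter (fun x : Fin n => (x : ℕ) < m)).card ≤ (range m).card := by
        refine card_le_card_of_injOn (fun u : Fin n => (u : ℕ)) ?_ Fin.val_injective.injOn
        intro u hu
        simpa using hu
      simpa using this
    have h3 : ((T.card * (k - r) : ℕ) : ℝ) ≤ m := by exact_mod_cast h1.trans hA
    push_cast [hrk.le] at h3
    have hkr : (0 : ℝ) < k - r := by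
      have : (r : ℝ) < k := by exact_mod_cast hrk
      linarith
    have h2' : ((T.biUnion id).card : ℝ) ≤ k * T.card := by exact_mod_cast h2
    refine h2'.trans ?_
    rw [mul_div_assoc, mul_assoc]
    gcongr
    rw [div_mul_eq_mul_div, le_div_iff₀ hkr]
    linarith

end RTTaux

open RTT in
/-- For all `k ≥ 3` and `1 ≤ r ≤ k-1`, every `0 < η < 1 - r/k` and every
`α > 0`, for all sufficiently large `n` there is an `n`-vertex graph `G` with `δ(G) ≥ ηn`
and `α_r(G) ≤ αn` in which every `K_k`-tiling covers at most `(1-μ)n` vertices, where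
`μ = 1 - kη/(k-r)`. -/
theorem lower_bound_clique_alpha_r :
    ∀ k r : ℕ, 3 ≤ k → 1 ≤ r → r ≤ k - 1 →
    ∀ η α : ℝ, 0 < η → η < 1 - (r : ℝ) / (k : ℝ) → 0 < α →
    ∃ N : ℕ, ∀ n : ℕ, N ≤ n →
      ∃ G : SimpleGraph (Fin n),
        MinDegGE G (η * n) ∧ IndepBound G r (α * n) ∧
        ∀ T : Finset (Finset (Fin n)), IsTiling (⊤ : SimpleGraph (Fin k)) G T →
          ((T.biUnion id).card : ℝ) ≤
            (1 - (1 - (k : ℝ) * η / ((k : ℝ) - (r : ℝ)))) * n := by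
  intro k r hk hr hrk η α hη0 hη hα
  have hkR : (0 : ℝ) < k := by exact_mod_cast (by omega : 0 < k)
  rcases Nat.lt_or_ge 1 r with h | h
  · have hη1 : η < 1 := by
      have : (0 : ℝ) ≤ (r : ℝ) / k := by positivity
      linarith
    simpa only [sub_sub_cancel] using RTTaux.case_two k r h (by omega) η α hη0 hη1 hα
  · obtain rfl : r = 1 := by omega
    rw [Nat.cast_one] at hη
    simpa only [sub_sub_cancel, Nat.cast_one] using RTTaux.case_one k hk η α hη0 hη hα
end
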